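/- arXiv:1111.1320 — 2 statements merged into one kernel-verified Lean document; each statement's English description precedes it below -/
import Mathlib

section
/- For 1 ≤ k ≤ a, the odd Schur polynomial of the column partition (1^k) = (1,…,1) (k ones) satisfies s_{(1^k)}(x_1,…,x_a) = (−1)^{k(k−1)/2} ε_k(x_1,…,x_a) in OΛ_a. -/
open scoped BigOperators

/-- The defining anticommutation relations of the odd polynomial ring. -/
inductive OddRel (a : ℕ) : FreeAlgebra ℤ (Fin a) → FreeAlgebra ℤ (Fin a) → Prop
  | anticomm (i j : Fin a) (h : i ≠ j) :
      OddRel a (FreeAlgebra.ι ℤ i * FreeAlgebra.ι ℤ j)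
        (-(FreeAlgebra.ι ℤ j * FreeAlgebra.ι ℤ i))

/-- The ring of odd polynomials in `a` variables over `ℤ`. -/
abbrev OPol (a : ℕ) : Type := RingQuot (OddRel a)

/-- The variable `x_{i+1}` (`0`-based index). -/
noncomputable def OX {a : ℕ} (i : Fin a) : OPol a :=
  RingQuot.mkRingHom (OddRel a) (FreeAlgebra.ι ℤ i)

/-- The variable `x_i` (`1`-based index), `0` if out of range. -/
noncomputable def xv (a : ℕ) (i : ℕ) : OPol a :=
  if h : 1 ≤ i ∧ i ≤ a then OX ⟨i - 1, by omega⟩ else 0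

/-- The signed variable `x̃_i = (−1)^{i−1} x_i` (`0`-based index, so the sign is `(−1)^i`). -/
noncomputable def xt (a : ℕ) (i : Fin a) : OPol a := (-1 : OPol a) ^ (i : ℕ) * OX i

/-- Odd elementary symmetric polynomial `ε_k`. -/
noncomputable def eps (a k : ℕ) : OPol a :=
  ∑ t ∈ Finset.powersetCard k (Finset.univ : Finset (Fin a)),
    ((t.sort (· ≤ ·)).map (xt a)).prod

/-- Odd complete symmetric polynomial `h_k`. -/
noncomputable def hp (a k : ℕ) : OPol a :=
  ∑ σ : Sym (Fin a) k, (((σ : Multiset (Fin a)).sort (· ≤ ·)).map (xt a)).prod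

/-- The ordered monomial `x_1^{c_1} ⋯ x_a^{c_a}`. -/
noncomputable def xmon {a : ℕ} (c : Fin a → ℕ) : OPol a :=
  ((List.finRange a).map fun i => OX i ^ c i).prod

/-- The staircase monomial `x^{δ_a} = x_1^{a−1} x_2^{a−2} ⋯ x_a^0`. -/
noncomputable def xdelta (a : ℕ) : OPol a :=
  ((List.finRange a).map fun i => OX i ^ (a - 1 - (i : ℕ))).prod

/-- Composite of the operators `d i` along a word, leftmost letter acting last (outermost). -/
noncomputable def dword {a : ℕ} (d : ℕ → OPol a →+ OPol a) : List ℕ → (OPol a →+ OPol a)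
  | [] => AddMonoidHom.id _
  | i :: l => (d i).comp (dword d l)

/-- The word `1, (2,1), (3,2,1), …, (a−1,…,2,1)` for the longest element, so that
`dword d (DList a) = ∂_1∘(∂_2∘∂_1)∘⋯∘(∂_{a−1}∘⋯∘∂_1) = D_a`. -/
def DList (a : ℕ) : List ℕ :=
  ((List.range a).map fun b => (List.range b).reverse.map (· + 1)).flatten

/-- Left multiplication by `f` as a `ℤ`-linear endomorphism. -/
noncomputable def mulL {a : ℕ} (f : OPol a) : Module.End ℤ (OPol a) :=
  (AddMonoidHom.mulLeft f).toIntLinearMap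

/-- The generators of the odd nilHecke ring inside `End_ℤ(OPol a)`. -/
noncomputable def onhGens (a : ℕ) (d : ℕ → OPol a →+ OPol a) :
    Set (Module.End ℤ (OPol a)) :=
  {T | (∃ i : Fin a, T = mulL (OX i)) ∨
    (∃ i : ℕ, 1 ≤ i ∧ i + 1 ≤ a ∧ T = (d i).toIntLinearMap)}

/-- The simple transposition `s_i` (`1`-based) of `{1,…,a}`. -/
def sperm (a : ℕ) (i : ℕ) : Equiv.Perm (Fin a) :=
  if h : 1 ≤ i ∧ i + 1 ≤ a then Equiv.swap ⟨i - 1, by omega⟩ ⟨i, by omega⟩ else 1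

/-- The permutation associated to a word in the simple transpositions. -/
def wordPerm (a : ℕ) (l : List ℕ) : Equiv.Perm (Fin a) := (l.map (sperm a)).prod

/-- Evaluation of an (even) multivariate polynomial at the squared variables `x_1², …, x_a²`. -/
noncomputable def sqEval {a : ℕ} (p : MvPolynomial (Fin a) ℤ) : OPol a :=
  ∑ m ∈ p.support,
    MvPolynomial.coeff m p • ((List.finRange a).map fun i => OX i ^ (2 * m i)).prod

/-- The odd symmetrization operator `S(f) = (−1)^{C(a,3)} w₀(D_a(f·x^{δ_a}))`. -/
noncomputable def oddSymzn (a : ℕ) (d : ℕ → OPol a →+ OPol a) (W0 : OPol a →+* OPol a)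
    (f : OPol a) : OPol a :=
  (-1 : OPol a) ^ Nat.choose a 3 * W0 (dword d (DList a) (f * xdelta a))

/-- The odd Schur polynomial `s_α = (−1)^{C(a,3)} w₀(D_a(x^α·x^{δ_a}))`. -/
noncomputable def schurP (a : ℕ) (d : ℕ → OPol a →+ OPol a) (W0 : OPol a →+* OPol a)
    (α : Fin a → ℕ) : OPol a :=
  (-1 : OPol a) ^ Nat.choose a 3 * W0 (dword d (DList a) (xmon α * xdelta a))

/-- The 0-Hecke generator `∂̄_r = x_r ∘ ∂_r`. -/
noncomputable def dbar (a : ℕ) (d : ℕ → OPol a →+ OPol a) (r : ℕ) : OPol a →+ OPol a :=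
  (AddMonoidHom.mulLeft (xv a r)).comp (d r)

/-- The `ℤ`-span of products of exactly `n` variables: the degree-`2n` component of `OPol a`. -/
def degComp (a n : ℕ) : Submodule ℤ (OPol a) :=
  Submodule.span ℤ {f : OPol a | ∃ l : List (Fin a), l.length = n ∧ f = (l.map OX).prod}

/-- Odd Schubert polynomial `𝔰_w = ∂_{w⁻¹w₀}(x^{δ_a})` for a fixed choice `red` of
reduced expressions. -/
noncomputable def schubert (a : ℕ) (d : ℕ → OPol a →+ OPol a)
    (red : Equiv.Perm (Fin a) → List ℕ) (w : Equiv.Perm (Fin a)) : OPol a :=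
  dword d (red (w⁻¹ * Fin.revPerm)) (xdelta a)

/-- Product of odd elementary symmetric polynomials along the parts of a partition,
in non-increasing order. -/
noncomputable def epsPart (a : ℕ) {n : ℕ} (p : Nat.Partition n) : OPol a :=
  (((p.parts.sort (· ≤ ·)).reverse).map (eps a)).prod

/-- `x 1, …, x a` are anticommuting ring generators, and `d i` for `1 ≤ i < a` are the odd
divided differences twisted by the ring maps `s i`. -/
structure IsOddDivDiff {R : Type*} [Ring R] (a : ℕ) (x : ℕ → R) (s : ℕ → R →+* R)
    (d : ℕ → R →+ R) : Prop where
  anticomm : ∀ i j : ℕ, i ≠ j → x i * x j = -(x j * x i)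
  closure_eq_top : Subring.closure (x '' Set.Icc 1 a) = ⊤
  s_x : ∀ i j : ℕ, 1 ≤ i → i + 1 ≤ a → 1 ≤ j → j ≤ a →
    s i (x j) = if j = i then -x (i + 1) else if j = i + 1 then -x i else -x j
  d_one : ∀ i : ℕ, 1 ≤ i → i + 1 ≤ a → d i 1 = 0
  d_x : ∀ i j : ℕ, 1 ≤ i → i + 1 ≤ a → 1 ≤ j → j ≤ a →
    d i (x j) = if j = i ∨ j = i + 1 then 1 else 0
  leibniz : ∀ i : ℕ, 1 ≤ i → i + 1 ≤ a → ∀ f g : R,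
    d i (f * g) = d i f * g + s i f * d i g

/-- Composite of additive endomorphisms along a word, leftmost letter outermost. -/
def opWord {R : Type*} [Ring R] (d : ℕ → R →+ R) : List ℕ → (R →+ R)
  | [] => AddMonoidHom.id _
  | i :: l => (d i).comp (opWord d l)

theorem opWord_append {R : Type*} [Ring R] (d : ℕ → R →+ R) (l l' : List ℕ) (f : R) :
    opWord d (l ++ l') f = opWord d l (opWord d l' f) := by
  induction l with
  | nil => rfl
  | cons i l ih => simp [opWord, ih]

/-- The composite `∂_b ∘ ⋯ ∘ ∂_1`. -/
def opDown {R : Type*} [Ring R] (d : ℕ → R →+ R) (b : ℕ) : R →+ R :=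
  opWord d ((List.range b).reverse.map (· + 1))

theorem opDown_zero {R : Type*} [Ring R] (d : ℕ → R →+ R) (f : R) : opDown d 0 f = f := rfl

theorem opDown_succ {R : Type*} [Ring R] (d : ℕ → R →+ R) (b : ℕ) (f : R) :
    opDown d (b + 1) f = d (b + 1) (opDown d b f) := by
  simp [opDown, List.range_succ, opWord]

theorem opWord_DList_succ {R : Type*} [Ring R] (d : ℕ → R →+ R) (b : ℕ) (f : R) :
    opWord d (DList (b + 1)) f = opWord d (DList b) (opDown d b f) := by
  have : DList (b + 1) = DList b ++ (List.range b).reverse.map (· + 1) := by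
    simp [DList, List.range_succ]
  rw [this, opWord_append]
  rfl

theorem mem_DList {a i : ℕ} (h : i ∈ DList a) : 1 ≤ i ∧ i + 1 ≤ a := by
  simp only [DList, List.mem_flatten, List.mem_map, List.mem_range] at h
  obtain ⟨l, ⟨b, hb, rfl⟩, hi⟩ := h
  simp only [List.mem_map, List.mem_reverse, List.mem_range] at hi
  obtain ⟨j, hj, rfl⟩ := hi
  omega

namespace IsOddDivDiff

variable {R : Type*} [Ring R] {a : ℕ} {x : ℕ → R} {s : ℕ → R →+* R} {d : ℕ → R →+ R}

theorem induction_on (H : IsOddDivDiff a x s d) {P : R → Prop} (one : P 1)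
    (add : ∀ f g, P f → P g → P (f + g)) (neg : ∀ f, P f → P (-f))
    (var_mul : ∀ j, 1 ≤ j → j ≤ a → ∀ f, P f → P (x j * f)) (f : R) : P f := by
  have zero : P 0 := by simpa using add _ _ one (neg _ one)
  suffices h : ∀ g, P g → P (f * g) by simpa using h 1 one
  have hf : f ∈ Subring.closure (x '' Set.Icc 1 a) := by simp [H.closure_eq_top]
  induction hf using Subring.closure_induction with
  | mem y hy =>
    obtain ⟨j, hj, rfl⟩ := hy
    exact var_mul j hj.1 hj.2
  | zero => simpa using fun _ _ => zero
  | one => simp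
  | add y z _ _ hy hz =>
    intro g hg
    rw [add_mul]
    exact add _ _ (hy g hg) (hz g hg)
  | neg y _ hy =>
    intro g hg
    rw [neg_mul]
    exact neg _ (hy g hg)
  | mul y z _ _ hy hz =>
    intro g hg
    rw [mul_assoc]
    exact hy _ (hz g hg)

theorem d_left (H : IsOddDivDiff a x s d) {i : ℕ} (h1 : 1 ≤ i) (h2 : i + 1 ≤ a) (f : R) :
    d i (x i * f) = f - x (i + 1) * d i f := by
  rw [H.leibniz i h1 h2, H.d_x i i h1 h2 h1 (by omega), H.s_x i i h1 h2 h1 (by omega)]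
  simp [sub_eq_add_neg]

theorem d_right (H : IsOddDivDiff a x s d) {i : ℕ} (h1 : 1 ≤ i) (h2 : i + 1 ≤ a) (f : R) :
    d i (x (i + 1) * f) = f - x i * d i f := by
  rw [H.leibniz i h1 h2, H.d_x i (i + 1) h1 h2 (by omega) (by omega),
    H.s_x i (i + 1) h1 h2 (by omega) (by omega)]
  simp [sub_eq_add_neg]

theorem d_far (H : IsOddDivDiff a x s d) {i j : ℕ} (h1 : 1 ≤ i) (h2 : i + 1 ≤ a)
    (hj1 : 1 ≤ j) (hj2 : j ≤ a) (hi : j ≠ i) (hi' : j ≠ i + 1) (f : R) :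
    d i (x j * f) = -(x j * d i f) := by
  rw [H.leibniz i h1 h2, H.d_x i j h1 h2 hj1 hj2, H.s_x i j h1 h2 hj1 hj2]
  simp [hi, hi']

theorem d_d (H : IsOddDivDiff a x s d) {i : ℕ} (h1 : 1 ≤ i) (h2 : i + 1 ≤ a) (f : R) :
    d i (d i f) = 0 := by
  induction f using H.induction_on with
  | one => simp [H.d_one i h1 h2]
  | add f g hf hg => simp [hf, hg]
  | neg f hf => simp [hf]
  | var_mul j hj1 hj2 f hf =>
    by_cases hi : j = i
    · subst hi
      simp [H.d_left h1 h2, H.d_right h1 h2, hf]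
    by_cases hi' : j = i + 1
    · subst hi'
      simp [H.d_left h1 h2, H.d_right h1 h2, hf]
    simp [H.d_far h1 h2 hj1 hj2 hi hi', hf]

theorem d_anticomm (H : IsOddDivDiff a x s d) {i m : ℕ} (h1 : 1 ≤ i) (him : i + 2 ≤ m)
    (h2 : m + 1 ≤ a) (f : R) : d i (d m f) = -d m (d i f) := by
  have hi2 : i + 1 ≤ a := by omega
  have hm1 : 1 ≤ m := by omega
  induction f using H.induction_on with
  | one => simp [H.d_one i h1 hi2, H.d_one m hm1 h2]
  | add f g hf hg => simp [hf, hg]; abel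
  | neg f hf => simp [hf]
  | var_mul j hj1 hj2 f hf =>
    by_cases hi : j = i
    · subst hi
      rw [H.d_left h1 hi2, H.d_far hm1 h2 hj1 hj2 (by omega) (by omega), map_neg,
        H.d_left h1 hi2, map_sub, H.d_far hm1 h2 (by omega) (by omega) (by omega) (by omega), hf]
      noncomm_ring
    by_cases hi' : j = i + 1
    · subst hi'
      rw [H.d_right h1 hi2, H.d_far hm1 h2 hj1 hj2 (by omega) (by omega), map_neg,
        H.d_right h1 hi2, map_sub, H.d_far hm1 h2 (by omega) (by omega) (by omega) (by omega), hf]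
      noncomm_ring
    by_cases hm : j = m
    · subst hm
      rw [H.d_left hm1 h2, H.d_far h1 hi2 hj1 hj2 hi hi', map_neg,
        H.d_left hm1 h2, map_sub, H.d_far h1 hi2 (by omega) (by omega) (by omega) (by omega), hf]
      noncomm_ring
    by_cases hm' : j = m + 1
    · subst hm'
      rw [H.d_right hm1 h2, H.d_far h1 hi2 hj1 hj2 hi hi', map_neg,
        H.d_right hm1 h2, map_sub, H.d_far h1 hi2 (by omega) (by omega) (by omega) (by omega), hf]
      noncomm_ring
    rw [H.d_far h1 hi2 hj1 hj2 hi hi', H.d_far hm1 h2 hj1 hj2 hm hm', map_neg, map_neg,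
      H.d_far h1 hi2 hj1 hj2 hi hi', H.d_far hm1 h2 hj1 hj2 hm hm', hf]
    noncomm_ring

theorem d_braid (H : IsOddDivDiff a x s d) {i : ℕ} (h1 : 1 ≤ i) (h2 : i + 2 ≤ a) (f : R) :
    d i (d (i + 1) (d i f)) = d (i + 1) (d i (d (i + 1) f)) := by
  have hi2 : i + 1 ≤ a := by omega
  have hm1 : 1 ≤ i + 1 := by omega
  have hm2 : i + 1 + 1 ≤ a := by omega
  have dl := fun f => H.d_left h1 hi2 f
  have dr := fun f => H.d_right h1 hi2 f
  have df := fun f => H.d_far (j := i + 1 + 1) h1 hi2 (by omega) (by omega) (by omega) (by omega) f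
  have el := fun f => H.d_left hm1 hm2 f
  have er := fun f => H.d_right hm1 hm2 f
  have ef := fun f => H.d_far (j := i) hm1 hm2 (by omega) (by omega) (by omega) (by omega) f
  have dd := fun f => H.d_d h1 hi2 f
  have ee := fun f => H.d_d hm1 hm2 f
  induction f using H.induction_on with
  | one => simp [H.d_one i h1 hi2, H.d_one (i + 1) hm1 hm2]
  | add f g hf hg => simp [hf, hg]
  | neg f hf => simp [hf]
  | var_mul j hj1 hj2 f hf =>
    by_cases hi : j = i
    · subst hi
      simp [dl, df, el, ef, dd, ee, hf]
    by_cases hi' : j = i + 1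
    · subst hi'
      simp only [dl, dr, el, er, ef, df, map_sub, map_neg, hf]
      abel
    by_cases hm : j = i + 1 + 1
    · subst hm
      simp [dr, df, er, ef, dd, ee, hf]
    have dg := fun f => H.d_far h1 hi2 hj1 hj2 hi hi' f
    have eg := fun f => H.d_far hm1 hm2 hj1 hj2 hi' hm f
    simp [dg, eg, hf]

theorem opDown_ker_far (H : IsOddDivDiff a x s d) {b m : ℕ} (hb : b + 2 ≤ m) (hm : m + 1 ≤ a)
    {f : R} (hf : d m f = 0) : d m (opDown d b f) = 0 := by
  induction b with
  | zero => simpa [opDown_zero] using hf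
  | succ b ih =>
    have := H.d_anticomm (i := b + 1) (m := m) (by omega) (by omega) hm (opDown d b f)
    rw [ih (by omega), map_zero] at this
    rw [opDown_succ, ← neg_eq_zero, ← this]

theorem opDown_ker_one {b : ℕ} (hb : 1 ≤ b) {f : R} (hf : d 1 f = 0) : opDown d b f = 0 := by
  induction b, hb using Nat.le_induction with
  | base => simpa [opDown_succ, opDown_zero] using hf
  | succ b hb ih => simp [opDown_succ, ih]

theorem opDown_ker_succ (H : IsOddDivDiff a x s d) {b j : ℕ} (hj : 1 ≤ j) (hjb : j + 1 ≤ b)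
    (hb : b + 1 ≤ a) {f : R} (hf : d (j + 1) f = 0) : d j (opDown d b f) = 0 := by
  induction b, hjb using Nat.le_induction with
  | base =>
    obtain ⟨j, rfl⟩ : ∃ i, j = i + 1 := ⟨j - 1, by omega⟩
    rw [opDown_succ, opDown_succ, H.d_braid hj (by omega),
      H.opDown_ker_far (by omega) (by omega) hf]
    simp
  | succ b hjb ih =>
    rw [opDown_succ, H.d_anticomm hj (by omega) hb, ih (by omega)]
    simp

/-- The longest composite `D_{b+1}` factors through every `∂_i`, `1 ≤ i ≤ b`, on the right. -/
theorem opWord_DList_ker (H : IsOddDivDiff a x s d) {b i : ℕ} (hi : 1 ≤ i) (hib : i ≤ b)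
    (hb : b + 1 ≤ a) {f : R} (hf : d i f = 0) : opWord d (DList (b + 1)) f = 0 := by
  induction b generalizing i f with
  | zero => omega
  | succ b ih =>
    rw [opWord_DList_succ]
    obtain rfl | hi1 := hi.eq_or_lt
    · rw [opDown_ker_one hib hf, map_zero]
    · obtain ⟨j, rfl⟩ : ∃ j, i = j + 1 := ⟨i - 1, by omega⟩
      exact ih (by omega) (by omega) (by omega) (H.opDown_ker_succ (by omega) hib hb hf)

theorem opWord_mul_right (H : IsOddDivDiff a x s d) {g : R}
    (hg : ∀ i, 1 ≤ i → i + 1 ≤ a → d i g = 0) {l : List ℕ}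
    (hl : ∀ i ∈ l, 1 ≤ i ∧ i + 1 ≤ a) (f : R) :
    opWord d l (f * g) = opWord d l f * g := by
  induction l with
  | nil => rfl
  | cons i l ih =>
    have hi := hl i (by simp)
    have := ih fun j hj => hl j (by simp [hj])
    simp [opWord, this, H.leibniz i hi.1 hi.2, hg i hi.1 hi.2]

/-- Products of the same variables in different orders agree up to sign. -/
theorem prod_perm (H : IsOddDivDiff a x s d) {l l' : List ℕ} (h : l.Perm l') :
    (l.map x).prod = (l'.map x).prod ∨ (l.map x).prod = -(l'.map x).prod := by
  induction h with
  | nil => simp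
  | cons i _ ih => rcases ih with h | h <;> simp [h]
  | swap i j l =>
    by_cases hij : i = j
    · simp [hij]
    · right
      simp [← mul_assoc, H.anticomm j i (Ne.symm hij)]
  | trans _ _ h₁ h₂ =>
    rcases h₁ with h₁ | h₁ <;> rcases h₂ with h₂ | h₂ <;> simp [h₁, h₂]

/-- Products of variables in which `x i` and `x (i + 1)` occur equally often are killed
by `d i`. -/
theorem d_prod_eq_zero (H : IsOddDivDiff a x s d) {i : ℕ} (h1 : 1 ≤ i) (h2 : i + 1 ≤ a)
    {l : List ℕ} (hl : ∀ j ∈ l, 1 ≤ j ∧ j ≤ a) (hc : l.count i = l.count (i + 1)) :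
    d i (l.map x).prod = 0 := by
  induction hn : l.length using Nat.strong_induction_on generalizing l with
  | _ n ih =>
    have perm : ∀ l', l.Perm l' → d i (l'.map x).prod = 0 → d i (l.map x).prod = 0 := by
      intro l' hp h
      rcases H.prod_perm hp with h' | h' <;> simp [h', h]
    by_cases hex : ∃ j ∈ l, j ≠ i ∧ j ≠ i + 1
    · obtain ⟨j, hj, hi, hi'⟩ := hex
      have hp := List.perm_cons_erase hj
      refine perm _ hp ?_
      have hlen := hp.length_eq
      rw [List.length_cons] at hlen
      rw [hp.count_eq, hp.count_eq, List.count_cons_of_ne hi, List.count_cons_of_ne hi'] at hc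
      rw [List.map_cons, List.prod_cons, H.d_far h1 h2 (hl j hj).1 (hl j hj).2 hi hi',
        ih _ (by omega) (fun m hm => hl m (List.mem_of_mem_erase hm)) hc rfl]
      simp
    · push Not at hex
      by_cases hi : i ∈ l
      · have hi' : i + 1 ∈ l := by
          rw [← List.count_pos_iff] at hi ⊢
          omega
        have hp := (List.perm_cons_erase hi).trans
          ((List.perm_cons_erase ((List.mem_erase_of_ne (by omega)).2 hi')).cons i)
        refine perm _ hp ?_
        have hlen := hp.length_eq
        simp only [List.length_cons] at hlen
        rw [hp.count_eq, hp.count_eq] at hc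
        simp only [List.map_cons, List.prod_cons]
        rw [H.d_left h1 h2, H.d_right h1 h2,
          ih _ (by omega) (fun m hm => hl m (List.mem_of_mem_erase (List.mem_of_mem_erase hm)))
            (by simpa [List.count_cons] using hc) rfl]
        simp
      · have hl0 : l = [] := by
          rw [List.eq_nil_iff_forall_not_mem]
          intro j hj
          rw [← List.count_eq_zero] at hi
          have hj' := hex j hj
          by_cases hji : j = i
          · subst hji
            exact List.count_eq_zero.1 hi hj
          · rw [hj' hji] at hj
            exact List.count_eq_zero.1 (hc.symm.trans hi) hj
        simp [hl0, H.d_one i h1 h2]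

end IsOddDivDiff

theorem map_neg_one_pow_mul {R : Type*} [Ring R] (φ : R →+ R) (e : ℕ) (f : R) :
    φ ((-1) ^ e * f) = (-1) ^ e * φ f := by
  rcases neg_one_pow_eq_or R e with h | h <;> simp [h]

/-- The monomial `x_{m+1}^n x_{m+2}^{n-1} ⋯ x_{m+n}`. -/
def stair {R : Type*} [Ring R] (x : ℕ → R) : ℕ → ℕ → R
  | _, 0 => 1
  | m, n + 1 => x (m + 1) ^ (n + 1) * stair x (m + 1) n

/-- The monomial `x_1^N x_2^{N-1} ⋯ x_m^{N-m+1}`, with exponents truncated at `0`. -/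
def stairInit {R : Type*} [Ring R] (x : ℕ → R) (N m : ℕ) : R :=
  ((List.range m).map fun i => x (i + 1) ^ (N - i)).prod

section Stair

variable {R : Type*} [Ring R] (x : ℕ → R)

theorem stair_eq_mul (m n : ℕ) : stair x m n = x (m + 1) ^ n * stair x (m + 1) (n - 1) := by
  cases n <;> simp [stair]

theorem stairInit_succ (N m : ℕ) :
    stairInit x N (m + 1) = stairInit x N m * x (m + 1) ^ (N - m) := by
  simp [stairInit, List.range_succ]

theorem stairInit_mul_stair (N m : ℕ) : stairInit x N m * stair x m (N - m) = stair x 0 N := by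
  induction m with
  | zero => simp [stairInit]
  | succ m ih => rw [← ih, stairInit_succ, stair_eq_mul x m, mul_assoc, Nat.sub_sub]

theorem stairInit_eq_stair {N m : ℕ} (h : N ≤ m) : stairInit x N m = stair x 0 N := by
  rw [← stairInit_mul_stair x N m, Nat.sub_eq_zero_of_le h]
  simp [stair]

theorem exists_stairInit_eq_prod (N m : ℕ) :
    ∃ l : List ℕ, stairInit x N m = (l.map x).prod ∧ (∀ j ∈ l, 1 ≤ j ∧ j ≤ m) ∧
      ∀ j, l.count (j + 1) = if j < m then N - j else 0 := by
  induction m with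
  | zero => exact ⟨[], by simp [stairInit]⟩
  | succ m ih =>
    obtain ⟨l, h1, h2, h3⟩ := ih
    refine ⟨l ++ List.replicate (N - m) (m + 1), ?_, ?_, ?_⟩
    · simp [stairInit_succ, h1]
    · intro j hj
      rw [List.mem_append] at hj
      rcases hj with hj | hj
      · have := h2 j hj
        omega
      · have := List.eq_of_mem_replicate hj
        omega
    · intro j
      rw [List.count_append, h3, List.count_replicate]
      rcases lt_trichotomy j m with h | h | h
      · simp [h, h.ne', Nat.lt_succ_of_lt h]
      · simp [h]
      · simp [h.ne, h.not_gt, Nat.not_lt.2 (Nat.succ_le_of_lt h)]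

theorem mul_pow_anticomm {y z : R} (h : y * z = -(z * y)) (e : ℕ) :
    y * z ^ e = (-1) ^ e * (z ^ e * y) := by
  induction e with
  | zero => simp
  | succ e ih =>
    rw [pow_succ z, ← mul_assoc, ih, mul_assoc, mul_assoc, h, pow_succ]
    noncomm_ring

variable {x}

theorem mul_stairInit (hx : ∀ i j : ℕ, i ≠ j → x i * x j = -(x j * x i)) (N j m : ℕ) :
    x (j + 1) * stairInit x N m =
      (-1) ^ ((∑ i ∈ Finset.range m, (N - i)) + if j < m then N - j else 0) *
        (stairInit x N m * x (j + 1)) := by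
  induction m with
  | zero => simp [stairInit]
  | succ m ih =>
    rw [stairInit_succ, ← mul_assoc, ih, Finset.sum_range_succ]
    by_cases hj : j = m
    · subst hj
      simp only [lt_irrefl, if_false, add_zero, Nat.lt_succ_self, if_true, mul_assoc,
        ← pow_succ', ← pow_succ]
      rw [add_assoc, pow_add _ _ (N - j + (N - j)), Even.neg_one_pow (n := N - j + (N - j)) ⟨_, rfl⟩]
      simp
    · have hlt : j < m + 1 ↔ j < m := by omega
      simp only [hlt]
      rw [mul_assoc, mul_assoc, mul_pow_anticomm (hx _ _ (by omega)), ← mul_assoc _ ((-1) ^ (N - m)),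
        (Commute.neg_one_right _).pow_right (N - m) |>.eq, mul_assoc, ← mul_assoc ((-1) ^ _),
        ← pow_add, mul_assoc, add_right_comm]

theorem prod_mul_stairInit (hx : ∀ i j : ℕ, i ≠ j → x i * x j = -(x j * x i)) (N m : ℕ) {k : ℕ}
    (hk : k ≤ m) :
    ((List.range k).map fun j => x (j + 1)).prod * stairInit x N m =
      (-1) ^ (∑ j ∈ Finset.range k, ((∑ i ∈ Finset.range m, (N - i)) + (N - j))) *
        (stairInit x N m * ((List.range k).map fun j => x (j + 1)).prod) := by
  induction k with
  | zero => simp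
  | succ k ih =>
    rw [List.range_succ, List.map_append, List.prod_append, Finset.sum_range_succ, pow_add,
      List.map_singleton, List.prod_singleton, mul_assoc, mul_stairInit hx, if_pos (by omega),
      ← mul_assoc, (Commute.neg_one_right _).pow_right _ |>.eq, mul_assoc, ← mul_assoc _ _ (x _),
      ih (by omega), ← mul_assoc, ← mul_assoc, ← pow_add, ← pow_add, add_comm, mul_assoc, mul_assoc]

end Stair

theorem neg_one_pow_sum_stair {R : Type*} [Ring R] (N : ℕ) :
    (-1 : R) ^ (∑ i ∈ Finset.range (N + 1), ∑ l ∈ Finset.range i, (N - l)) =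
      (-1) ^ (N + 1).choose 2 := by
  induction N with
  | zero => simp
  | succ N ih =>
    have h : ∑ i ∈ Finset.range (N + 1 + 1), ∑ l ∈ Finset.range i, (N + 1 - l) =
        (N + 1) * (N + 1) + ∑ i ∈ Finset.range (N + 1), ∑ l ∈ Finset.range i, (N - l) := by
      rw [Finset.sum_range_succ']
      simp only [Finset.sum_range_succ' (fun l => N + 1 - l), Nat.add_sub_add_right,
        Finset.sum_add_distrib]
      simp
      ring
    rw [h, pow_add, ih, Nat.choose_succ_succ' (N + 1) 1, pow_add, Nat.choose_one_right, pow_mul]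
    rcases Nat.even_or_odd (N + 1) with h | h
    · simp [h.neg_one_pow]
    · simp [h.neg_one_pow]

namespace IsOddDivDiff

variable {R : Type*} [Ring R] {a : ℕ} {x : ℕ → R} {s : ℕ → R →+* R} {d : ℕ → R →+ R}

theorem d_far_pow (H : IsOddDivDiff a x s d) {i j : ℕ} (h1 : 1 ≤ i) (h2 : i + 1 ≤ a)
    (hj1 : 1 ≤ j) (hj2 : j ≤ a) (hi : j ≠ i) (hi' : j ≠ i + 1) (e : ℕ) (f : R) :
    d i (x j ^ e * f) = (-1) ^ e * (x j ^ e * d i f) := by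
  induction e with
  | zero => simp
  | succ e ih =>
    rw [pow_succ', mul_assoc, H.d_far h1 h2 hj1 hj2 hi hi', ih, pow_succ', ← mul_assoc (x j),
      (Commute.neg_one_right (x j)).pow_right e |>.eq]
    noncomm_ring

theorem d_stair (H : IsOddDivDiff a x s d) {i m n : ℕ} (h1 : 1 ≤ i) (him : i + 1 ≤ m)
    (hm : m + n ≤ a) : d i (stair x m n) = 0 := by
  induction n generalizing m with
  | zero => exact H.d_one i h1 (by omega)
  | succ n ih =>
    rw [stair, H.d_far_pow h1 (by omega) (by omega) (by omega) (by omega) (by omega),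
      ih (by omega) (by omega)]
    simp

theorem d_stairInit_mul (H : IsOddDivDiff a x s d) {i j : ℕ} (N : ℕ) (h1 : 1 ≤ i)
    (h2 : i + 1 ≤ a) (hji : j < i) (f : R) :
    d i (stairInit x N j * f) =
      (-1) ^ (∑ l ∈ Finset.range j, (N - l)) * (stairInit x N j * d i f) := by
  induction j generalizing f with
  | zero => simp [stairInit]
  | succ j ih =>
    rw [stairInit_succ, mul_assoc, ih (by omega),
      H.d_far_pow h1 h2 (by omega) (by omega) (by omega) (by omega), Finset.sum_range_succ,
      pow_add, mul_assoc, mul_assoc, ← mul_assoc (stairInit x N j) ((-1) ^ _),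
      (Commute.neg_one_right (stairInit x N j)).pow_right (N - j) |>.eq, mul_assoc]

theorem d_pow_mul_pow (H : IsOddDivDiff a x s d) {i : ℕ} (h1 : 1 ≤ i) (h2 : i + 1 ≤ a) (n : ℕ)
    {g : R} (hg : d i g = 0) : d i (x i ^ n * (x (i + 1) ^ n * g)) = 0 := by
  induction n with
  | zero => simpa using hg
  | succ n ih =>
    have hswap : x i ^ n * x (i + 1) = (-1) ^ n * (x (i + 1) * x i ^ n) := by
      rw [mul_pow_anticomm (H.anticomm (i + 1) i (by omega)), ← mul_assoc, ← pow_add,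
        Even.neg_one_pow ⟨n, rfl⟩, one_mul]
    have : x i ^ (n + 1) * (x (i + 1) ^ (n + 1) * g) =
        (-1) ^ n * (x i * (x (i + 1) * (x i ^ n * (x (i + 1) ^ n * g)))) := by
      rw [pow_succ', pow_succ' (x (i + 1)), mul_assoc (x i), mul_assoc (x (i + 1)),
        ← mul_assoc (x i ^ n), hswap, ← mul_assoc, ← mul_assoc (x i),
        (Commute.neg_one_right (x i)).pow_right n |>.eq]
      simp only [mul_assoc]
    rw [this, map_neg_one_pow_mul, H.d_left h1 h2, H.d_right h1 h2, ih]
    simp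

theorem opDown_stair (H : IsOddDivDiff a x s d) {N j : ℕ} (hN : N + 2 ≤ a) (hj : j ≤ N + 1) :
    opDown d j (stair x 0 (N + 1)) =
      (-1) ^ (∑ i ∈ Finset.range j, ∑ l ∈ Finset.range i, (N - l)) *
        (stairInit x N j * stair x j (N + 1 - j)) := by
  induction j with
  | zero => simp [opDown_zero, stairInit]
  | succ j ih =>
    have hd : d (j + 1) (stair x j (N - j + 1)) = x (j + 1) ^ (N - j) * stair x (j + 1) (N - j) := by
      have h0 : d (j + 1) (stair x (j + 1 + 1) (N - j - 1)) = 0 :=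
        H.d_stair (by omega) (by omega) (by omega)
      rw [stair, stair_eq_mul x (j + 1), pow_succ', mul_assoc, H.d_left (by omega) (by omega),
        H.d_pow_mul_pow (by omega) (by omega) _ h0]
      simp
    rw [opDown_succ, ih (by omega), map_neg_one_pow_mul, show N + 1 - j = N - j + 1 by omega,
      H.d_stairInit_mul N (by omega) (by omega) (by omega), hd, ← mul_assoc ((-1) ^ _), ← pow_add,
      ← Finset.sum_range_succ, stairInit_succ, Nat.add_sub_add_right, mul_assoc (stairInit x N j)]

theorem opWord_DList_stair (H : IsOddDivDiff a x s d) {n : ℕ} (hn : n + 1 ≤ a) :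
    opWord d (DList (n + 1)) (stair x 0 n) = (-1) ^ (n + 1).choose 3 := by
  induction n with
  | zero => simp [stair, DList, opWord, Nat.choose_eq_zero_of_lt]
  | succ n ih =>
    rw [opWord_DList_succ, H.opDown_stair (by omega) le_rfl, stairInit_eq_stair x (by omega),
      neg_one_pow_sum_stair, Nat.sub_self, stair, mul_one, map_neg_one_pow_mul, ih (by omega),
      ← pow_add, Nat.choose_succ_succ' (n + 1) 2]

end IsOddDivDiff

/-- The elementary symmetric sums of a list of noncommuting elements, with factors in the
order of the list. -/
def listEsymm {R : Type*} [Ring R] : List R → ℕ → R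
  | _, 0 => 1
  | [], _ + 1 => 0
  | y :: l, k + 1 => y * listEsymm l k + listEsymm l (k + 1)

section ListEsymm

variable {R : Type*} [Ring R]

theorem listEsymm_zero (l : List R) : listEsymm l 0 = 1 := by
  cases l <;> rfl

theorem listEsymm_map_eq_sum {ι : Type*} (f : ι → R) (l : List ι) (k : ℕ) :
    listEsymm (l.map f) k = ((l.sublistsLen k).map fun u => (u.map f).prod).sum := by
  induction l generalizing k with
  | nil => cases k <;> simp [listEsymm]
  | cons y l ih =>
    cases k with
    | zero => simp [listEsymm]
    | succ k =>
      rw [List.map_cons, listEsymm, ih, ih, List.sublistsLen_succ_cons, List.map_append, List.sum_append, add_comm,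
        List.map_map, ← List.sum_map_mul_left]
      simp [Function.comp_def]

theorem listEsymm_range (a k : ℕ) (z : ℕ → R) :
    listEsymm ((List.range a).map z) k =
      ∑ t ∈ Finset.powersetCard k (Finset.univ : Finset (Fin a)),
        ((t.sort (· ≤ ·)).map fun i : Fin a => z i).prod := by
  let F : Multiset (Fin a) → R := fun u => ((u.sort (· ≤ ·)).map fun i : Fin a => z i).prod
  have h1 : ∑ t ∈ Finset.powersetCard k (Finset.univ : Finset (Fin a)),
      ((t.sort (· ≤ ·)).map fun i : Fin a => z i).prod =
      (((Finset.univ : Finset (Fin a)).1.powersetCard k).map F).sum := by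
    rw [← Finset.map_val_val_powersetCard, Multiset.map_map]
    rfl
  have h2 : (Finset.univ : Finset (Fin a)).1 = (List.finRange a : Multiset (Fin a)) := rfl
  have h3 : (List.range a).map z = (List.finRange a).map fun i : Fin a => z i := by
    rw [← List.map_coe_finRange_eq_range, List.map_map]
    rfl
  rw [h1, h2, Multiset.powersetCard_coe, h3, listEsymm_map_eq_sum]
  simp only [Multiset.map_coe, Multiset.sum_coe, List.map_map]
  congr 1
  refine List.map_congr_left fun l hl => ?_
  have hp : l.Pairwise (· ≤ ·) :=
    (List.pairwise_le_finRange a).sublist (List.mem_sublistsLen.1 hl).1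
  simp [F, Multiset.coe_sort, List.mergeSort_eq_self (· ≤ ·) hp]

theorem listEsymm_append_singleton (l : List R) (y : R) (k : ℕ) :
    listEsymm (l ++ [y]) (k + 1) = listEsymm l k * y + listEsymm l (k + 1) := by
  induction l generalizing k with
  | nil => cases k <;> simp [listEsymm]
  | cons w l ih =>
    cases k with
    | zero =>
      simp only [List.cons_append, listEsymm, ih, listEsymm_zero]
      abel
    | succ k =>
      rw [List.cons_append, listEsymm, listEsymm, listEsymm, ih, ih]
      noncomm_ring

theorem listEsymm_anticomm {l : List R} {y : R} (h : ∀ w ∈ l, w * y = -(y * w)) (k : ℕ) :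
    listEsymm l k * y = (-1) ^ k * (y * listEsymm l k) := by
  induction l generalizing k with
  | nil => cases k <;> simp [listEsymm]
  | cons w l ih =>
    have ih := ih fun u hu => h u (by simp [hu])
    cases k with
    | zero => simp [listEsymm]
    | succ k =>
      have hc : w * (-1) ^ k = (-1) ^ k * w := ((Commute.neg_one_right w).pow_right k).eq
      rw [listEsymm, add_mul, mul_assoc, ih, ih, mul_add, mul_add, ← mul_assoc w, hc, mul_assoc,
        ← mul_assoc w, h w (by simp), pow_succ]
      noncomm_ring

theorem listEsymm_reverse {l : List R} (h : l.Pairwise fun y w => w * y = -(y * w)) (k : ℕ) :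
    listEsymm l.reverse k = (-1) ^ k.choose 2 * listEsymm l k := by
  induction l generalizing k with
  | nil => cases k <;> simp [listEsymm]
  | cons y l ih =>
    rw [List.pairwise_cons] at h
    cases k with
    | zero => simp [listEsymm_zero]
    | succ k =>
      rw [List.reverse_cons, listEsymm_append_singleton, ih h.2, ih h.2, mul_assoc,
        listEsymm_anticomm h.1, listEsymm, Nat.choose_succ_succ' k 1, Nat.choose_one_right, pow_add,
        mul_add, ← mul_assoc, (Commute.pow_pow_self (-1 : R) _ _).eq]

theorem map_listEsymm (φ : R →+* R) (l : List R) (k : ℕ) :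
    φ (listEsymm l k) = listEsymm (l.map φ) k := by
  induction l generalizing k with
  | nil => cases k <;> simp [listEsymm]
  | cons y l ih => cases k <;> simp [listEsymm, ih]

theorem listEsymm_neg_one_pow_mul (e : ℕ) (l : List R) (k : ℕ) :
    listEsymm (l.map fun y => (-1) ^ e * y) k = ((-1) ^ e) ^ k * listEsymm l k := by
  rcases neg_one_pow_eq_or R e with he | he
  · simp [he]
  rw [he]
  induction l generalizing k with
  | nil => cases k <;> simp [listEsymm]
  | cons y l ih =>
    cases k with
    | zero => simp [listEsymm]
    | succ k =>
      have hc : y * (-1) ^ k = (-1) ^ k * y := ((Commute.neg_one_right y).pow_right k).eq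
      rw [List.map_cons, listEsymm, listEsymm, ih, ih, mul_assoc, ← mul_assoc y, hc, pow_succ]
      noncomm_ring

end ListEsymm

/-- The signed variable `x̃_{j+1} = (-1)^j x_{j+1}`. -/
def signedVar {R : Type*} [Ring R] (x : ℕ → R) (j : ℕ) : R := (-1) ^ j * x (j + 1)

theorem prod_map_signedVar {R : Type*} [Ring R] (x : ℕ → R) (l : List ℕ) :
    (l.map (signedVar x)).prod = (-1) ^ l.sum * (l.map fun j => x (j + 1)).prod := by
  induction l with
  | nil => simp
  | cons j l ih =>
    have hc : x (j + 1) * (-1) ^ l.sum = (-1) ^ l.sum * x (j + 1) :=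
      ((Commute.neg_one_right _).pow_right _).eq
    simp only [List.map_cons, List.prod_cons, List.sum_cons, ih, signedVar, pow_add, mul_assoc]
    rw [← mul_assoc (x (j + 1)), hc, mul_assoc]

theorem exists_not_mem_succ_mem {a k : ℕ} {t : Finset (Fin a)} (ht : t.card = k)
    (hne : t ≠ Finset.univ.filter fun i : Fin a => (i : ℕ) < k) :
    ∃ i : ℕ, ∃ h : i + 1 < a, (⟨i, by omega⟩ : Fin a) ∉ t ∧ ⟨i + 1, h⟩ ∈ t := by
  by_contra! hcon
  have down : ∀ n m : ℕ, ∀ h : m + n < a, ⟨m + n, h⟩ ∈ t → (⟨m, by omega⟩ : Fin a) ∈ t := by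
    intro n
    induction n with
    | zero => intro m h hm; exact hm
    | succ n ih =>
      intro m h hm
      refine ih m (by omega) ?_
      by_contra hmt
      exact hcon (m + n) h hmt hm
  have hsub : t ⊆ Finset.univ.filter fun i : Fin a => (i : ℕ) < k := by
    intro j hj
    simp only [Finset.mem_filter, Finset.mem_univ, true_and]
    have hle : Finset.Iic j ⊆ t := by
      intro i hi
      have hij : i ≤ j := Finset.mem_Iic.1 hi
      refine down (j - i) i (by omega) ?_
      convert hj
      omega
    have := Finset.card_le_card hle
    rw [Fin.card_Iic, ht] at this
    omega
  refine hne (Finset.eq_of_subset_of_card_le hsub ?_)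
  rw [ht, Fin.card_filter_val_lt]
  exact min_le_right _ _

theorem sort_filter_val_lt {a k : ℕ} (hk : k ≤ a) :
    (((Finset.univ.filter fun i : Fin a => (i : ℕ) < k).sort (· ≤ ·)).map fun i : Fin a => (i : ℕ)) =
      List.range k := by
  refine List.Perm.eq_of_pairwise' (r := (· ≤ ·)) ?_ List.pairwise_le_range ?_
  · exact (Finset.pairwise_sort _ _).map _ fun _ _ h => h
  · rw [List.perm_ext_iff_of_nodup ((Finset.sort_nodup _ _).map Fin.val_injective)
      List.nodup_range]
    intro i
    simp only [List.mem_map, Finset.mem_sort, Finset.mem_filter, Finset.mem_univ, true_and,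
      List.mem_range]
    exact ⟨fun ⟨j, hj, hji⟩ => hji ▸ hj, fun hi => ⟨⟨i, by omega⟩, hi, rfl⟩⟩

namespace IsOddDivDiff

variable {R : Type*} [Ring R] {a : ℕ} {x : ℕ → R} {s : ℕ → R →+* R} {d : ℕ → R →+ R}

theorem signedVar_anticomm (H : IsOddDivDiff a x s d) {i j : ℕ} (h : i ≠ j) :
    signedVar x i * signedVar x j = -(signedVar x j * signedVar x i) := by
  have := H.anticomm (i + 1) (j + 1) (by omega)
  unfold signedVar
  rcases neg_one_pow_eq_or R i with hi | hi <;> rcases neg_one_pow_eq_or R j with hj | hj <;>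
    simp [hi, hj, this]

theorem d_signedVar_far (H : IsOddDivDiff a x s d) {i j : ℕ} (h1 : 1 ≤ i) (h2 : i + 1 ≤ a)
    (hj : j < a) (hi : j + 1 ≠ i) (hi' : j ≠ i) (f : R) :
    d i (signedVar x j * f) = -(signedVar x j * d i f) := by
  rw [signedVar, mul_assoc, map_neg_one_pow_mul,
    H.d_far h1 h2 (by omega) (by omega) hi (by omega), mul_neg, mul_assoc]

theorem d_listEsymm (H : IsOddDivDiff a x s d) {i : ℕ} (h1 : 1 ≤ i) (h2 : i + 1 ≤ a) {n m : ℕ}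
    (hmn : m + n = a) (hm : m + 1 ≤ i ∨ i + 1 ≤ m) (k : ℕ) :
    d i (listEsymm ((List.range' m n).map (signedVar x)) k) = 0 := by
  induction n using Nat.strong_induction_on generalizing m k with
  | _ n ih =>
    cases k with
    | zero => simp [listEsymm_zero, H.d_one i h1 h2]
    | succ k =>
      cases n with
      | zero => simp [listEsymm]
      | succ n =>
        by_cases hmi : m + 1 = i
        · obtain ⟨n, rfl⟩ : ∃ p, n = p + 1 := ⟨n - 1, by omega⟩
          subst hmi
          have ih' : ∀ k, d (m + 1)
              (listEsymm ((List.range' (m + 1 + 1) n).map (signedVar x)) k) = 0 := fun k =>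
            ih n (by omega) (by omega) (by omega) k
          have hl := fun f => H.d_left h1 h2 f
          have hr := fun f => H.d_right h1 h2 f
          simp only [List.range'_succ, List.map_cons]
          cases k with
          | zero =>
            simp only [listEsymm, listEsymm_zero, signedVar, pow_succ]
            rcases neg_one_pow_eq_or R m with he | he <;>
              simp [he, ih', H.d_x _ (m + 1) h1 h2 h1 (by omega),
                H.d_x _ (m + 1 + 1) h1 h2 (by omega) h2]
          | succ k =>
            rw [listEsymm, listEsymm, listEsymm, signedVar, signedVar, pow_succ]
            rcases neg_one_pow_eq_or R m with he | he <;>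
              simp [he, ih', hl, hr, mul_add]
        · rw [List.range'_succ, List.map_cons, listEsymm, map_add,
            H.d_signedVar_far h1 h2 (by omega) hmi (by omega),
            ih n (by omega) (by omega) (by omega), ih n (by omega) (by omega) (by omega)]
          simp

theorem opWord_stairInit_mul_eq_zero (H : IsOddDivDiff a x s d) {N i : ℕ} (hN : N + 1 = a)
    (hi : i + 1 < a) {l : List ℕ} (hl : ∀ j ∈ l, j < a) (hc : l.count (i + 1) = l.count i + 1) :
    opWord d (DList a) (stairInit x N a * (l.map fun j => x (j + 1)).prod) = 0 := by
  subst hN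
  refine H.opWord_DList_ker (i := i + 1) (by omega) (by omega) le_rfl ?_
  obtain ⟨l₀, h1, h2, h3⟩ := exists_stairInit_eq_prod x N (N + 1)
  have hcount : ∀ j, (l.map (· + 1)).count (j + 1) = l.count j := fun j =>
    List.count_map_of_injective l (· + 1) (add_left_injective 1) j
  have hprod : stairInit x N (N + 1) * (l.map fun j => x (j + 1)).prod =
      ((l₀ ++ l.map (· + 1)).map x).prod := by
    rw [h1, List.map_append, List.prod_append, List.map_map]
    rfl
  rw [hprod]
  refine H.d_prod_eq_zero (by omega) (by omega) ?_ ?_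
  · intro j hj
    simp only [List.mem_append, List.mem_map] at hj
    obtain hj | ⟨j, hj, rfl⟩ := hj
    · exact h2 j hj
    · have := hl j hj
      omega
  · rw [List.count_append, List.count_append, h3, h3, hcount, hcount, if_pos (by omega),
      if_pos (by omega), hc]
    omega

theorem opWord_stairInit_mul_listEsymm (H : IsOddDivDiff a x s d) {N k : ℕ} (hN : N + 1 = a)
    (hk : k ≤ a) :
    opWord d (DList a) (stairInit x N a * listEsymm ((List.range a).map (signedVar x)) k) =
      opWord d (DList a) (stairInit x N a * ((List.range k).map (signedVar x)).prod) := by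
  rw [listEsymm_range, Finset.mul_sum, map_sum,
    Finset.sum_eq_single (Finset.univ.filter fun i : Fin a => (i : ℕ) < k)]
  · rw [← sort_filter_val_lt hk, List.map_map]
    rfl
  · intro t ht hne
    obtain ⟨i, hi, hit, hit'⟩ := exists_not_mem_succ_mem (Finset.mem_powersetCard.1 ht).2 hne
    have hmap : ((t.sort (· ≤ ·)).map fun i : Fin a => signedVar x i) =
        ((t.sort (· ≤ ·)).map fun i : Fin a => (i : ℕ)).map (signedVar x) := by
      rw [List.map_map]
      rfl
    have hcount : ∀ j : Fin a, ((t.sort (· ≤ ·)).map fun i : Fin a => (i : ℕ)).count (j : ℕ) =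
        (t.sort (· ≤ ·)).count j := fun j =>
      List.count_map_of_injective _ _ Fin.val_injective j
    rw [hmap, prod_map_signedVar, ← mul_assoc, (Commute.neg_one_right _).pow_right _ |>.eq,
      mul_assoc, map_neg_one_pow_mul, H.opWord_stairInit_mul_eq_zero hN hi, mul_zero]
    · intro j hj
      obtain ⟨m, -, rfl⟩ := List.mem_map.1 hj
      exact m.2
    · rw [hcount ⟨i + 1, hi⟩, hcount ⟨i, by omega⟩,
        List.count_eq_one_of_mem (Finset.sort_nodup _ _) ((Finset.mem_sort _).2 hit'),
        List.count_eq_zero.2 (mt (Finset.mem_sort _).1 hit)]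
  · intro h
    refine absurd ?_ h
    simp [Finset.mem_powersetCard, Fin.card_filter_val_lt, hk]

theorem opWord_stairInit_mul_prod (H : IsOddDivDiff a x s d) {N k : ℕ} (hN : N + 1 = a)
    (hk : k ≤ a) :
    opWord d (DList a) (stairInit x N a * ((List.range k).map fun j => x (j + 1)).prod) =
      (-1) ^ ((List.range k).sum + a.choose 3) *
        listEsymm ((List.range a).map (signedVar x)) k := by
  have h := H.opWord_stairInit_mul_listEsymm hN hk
  rw [H.opWord_mul_right (fun i h1 h2 => by
      rw [List.range_eq_range']
      exact H.d_listEsymm h1 h2 (zero_add a) (by omega) k) (fun i => mem_DList),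
    prod_map_signedVar, ← mul_assoc, (Commute.neg_one_right _).pow_right _ |>.eq, mul_assoc,
    map_neg_one_pow_mul, stairInit_eq_stair x (by omega)] at h
  subst hN
  rw [H.opWord_DList_stair le_rfl, ← stairInit_eq_stair x (Nat.le_succ N)] at h
  rw [pow_add, mul_assoc, h, ← mul_assoc, ← pow_add, Even.neg_one_pow ⟨_, rfl⟩, one_mul]

theorem map_reversal_listEsymm (H : IsOddDivDiff a x s d) {N e : ℕ} (hN : N + 1 = a)
    {W : R →+* R} (hW : ∀ j < a, W (x (j + 1)) = (-1) ^ e * x (N - j + 1)) (k : ℕ) :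
    W (listEsymm ((List.range a).map (signedVar x)) k) =
      (-1) ^ ((e + N) * k + k.choose 2) * listEsymm ((List.range a).map (signedVar x)) k := by
  have hmap : ((List.range a).map (signedVar x)).map W =
      (((List.range a).map (signedVar x)).reverse).map fun y => (-1) ^ (e + N) * y := by
    rw [← List.map_reverse, List.range_eq_range', List.reverse_range', ← List.range_eq_range',
      List.map_map, List.map_map, List.map_map]
    refine List.map_congr_left fun j hj => ?_
    have hj := List.mem_range.1 hj
    have hsub : 0 + a - 1 - j = N - j := by omega
    have hsign : (-1 : R) ^ (N - j) = (-1) ^ (N + j) := by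
      rw [show N + j = N - j + (j + j) by omega, pow_add _ _ (j + j),
        Even.neg_one_pow (n := j + j) ⟨_, rfl⟩, mul_one]
    simp only [Function.comp_apply, signedVar, map_mul, map_pow, map_neg, map_one, hW j hj, hsub,
      hsign]
    rw [← mul_assoc, ← mul_assoc, ← pow_add, ← pow_add,
      show e + N + (N + j) = j + e + (N + N) by ring, pow_add _ _ (N + N),
      Even.neg_one_pow (n := N + N) ⟨_, rfl⟩, mul_one]
  have hpw : ((List.range a).map (signedVar x)).Pairwise fun y w => w * y = -(y * w) :=
    List.pairwise_map.2 (List.nodup_range.imp fun h => H.signedVar_anticomm h.symm)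
  rw [map_listEsymm, hmap, listEsymm_neg_one_pow_mul, listEsymm_reverse hpw, ← mul_assoc, ← pow_mul,
    ← pow_add]

/-- The column case of the odd Schur polynomials, with the sign of the reversal `W` explicit. -/
theorem schur_column (H : IsOddDivDiff a x s d) {N k : ℕ} (hN : N + 1 = a) (hk : k ≤ a)
    {W : R →+* R} (hW : ∀ j < a, W (x (j + 1)) = (-1) ^ a.choose 2 * x (N - j + 1)) :
    (-1) ^ a.choose 3 * W (opWord d (DList a)
        (((List.range k).map fun j => x (j + 1)).prod * stairInit x N a)) =
      (-1) ^ k.choose 2 * listEsymm ((List.range a).map (signedVar x)) k := by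
  have hsum : ∑ i ∈ Finset.range a, (N - i) = a.choose 2 := by
    subst hN
    have := Finset.sum_range_reflect (fun i => i) (N + 1)
    rw [Nat.add_sub_cancel] at this
    rw [this, Finset.sum_range_id, Nat.choose_two_right]
  have hexp : ∑ j ∈ Finset.range k, (a.choose 2 + (N - j)) + (List.range k).sum =
      (a.choose 2 + N) * k := by
    have : (List.range k).sum = ∑ j ∈ Finset.range k, j := by
      induction k with
      | zero => simp
      | succ k ih => rw [List.range_succ, Finset.sum_range_succ, ← ih (by omega)]; simp
    rw [this, ← Finset.sum_add_distrib, Finset.sum_congr rfl (g := fun _ => a.choose 2 + N)]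
    · simp [mul_comm]
    · intro j hj
      have := Finset.mem_range.1 hj
      omega
  rw [prod_mul_stairInit H.anticomm N a hk, map_neg_one_pow_mul, H.opWord_stairInit_mul_prod hN hk,
    hsum, ← mul_assoc, ← pow_add, ← add_assoc, hexp, map_mul, map_pow, map_neg, map_one,
    H.map_reversal_listEsymm hN hW, ← mul_assoc, ← mul_assoc, ← pow_add, ← pow_add]
  congr 1
  rw [show a.choose 3 + ((a.choose 2 + N) * k + a.choose 3) + ((a.choose 2 + N) * k + k.choose 2) =
    k.choose 2 + 2 * (a.choose 3 + (a.choose 2 + N) * k) by ring, pow_add, pow_mul]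
  simp

end IsOddDivDiff

theorem xv_anticomm (a : ℕ) {i j : ℕ} (h : i ≠ j) :
    xv a i * xv a j = -(xv a j * xv a i) := by
  unfold xv
  by_cases hi : 1 ≤ i ∧ i ≤ a
  · by_cases hj : 1 ≤ j ∧ j ≤ a
    · have hne : (⟨i - 1, by omega⟩ : Fin a) ≠ ⟨j - 1, by omega⟩ := by
        simp only [ne_eq, Fin.mk.injEq]
        omega
      have := RingQuot.mkRingHom_rel (OddRel.anticomm _ _ hne)
      rw [map_mul, map_neg, map_mul] at this
      rwa [dif_pos hi, dif_pos hj]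
    · rw [dif_neg hj, mul_zero, zero_mul, neg_zero]
  · rw [dif_neg hi, mul_zero, zero_mul, neg_zero]

theorem OX_eq_xv {a : ℕ} (i : Fin a) : OX i = xv a (i + 1) := by
  have : 1 ≤ (i : ℕ) + 1 ∧ (i : ℕ) + 1 ≤ a := by omega
  simp [xv, this]

theorem closure_xv_eq_top (a : ℕ) : Subring.closure (xv a '' Set.Icc 1 a) = ⊤ := by
  rw [eq_top_iff]
  rintro f -
  obtain ⟨f, rfl⟩ := RingQuot.mkRingHom_surjective (OddRel a) f
  induction f using FreeAlgebra.induction with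
  | grade0 r =>
    simp only [eq_intCast, map_intCast]
    exact intCast_mem _ r
  | grade1 i =>
    refine Subring.subset_closure ⟨i + 1, ⟨by omega, by omega⟩, (OX_eq_xv i).symm⟩
  | mul f g hf hg =>
    rw [map_mul]
    exact mul_mem hf hg
  | add f g hf hg =>
    rw [map_add]
    exact add_mem hf hg

theorem dword_eq_opWord {a : ℕ} (d : ℕ → OPol a →+ OPol a) (l : List ℕ) :
    dword d l = opWord d l := by
  induction l with
  | nil => rfl
  | cons i l ih => rw [dword, opWord, ih]

theorem map_OX_finRange {a : ℕ} {M : Type*} (g : OPol a → ℕ → M) :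
    ((List.finRange a).map fun i => g (OX i) i) =
      (List.range a).map fun i => g (xv a (i + 1)) i := by
  rw [← List.map_coe_finRange_eq_range, List.map_map]
  exact List.map_congr_left fun i _ => by rw [OX_eq_xv]; rfl

theorem xdelta_eq_stairInit (a : ℕ) : xdelta a = stairInit (xv a) (a - 1) a := by
  rw [xdelta, map_OX_finRange fun y i => y ^ (a - 1 - i)]
  rfl

theorem xmon_column {a k : ℕ} (hk : k ≤ a) :
    xmon (fun i : Fin a => if (i : ℕ) < k then 1 else 0) =
      ((List.range k).map fun j => xv a (j + 1)).prod := by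
  rw [xmon, map_OX_finRange fun y i => y ^ if i < k then 1 else 0]
  obtain ⟨n, rfl⟩ := Nat.exists_eq_add_of_le hk
  rw [List.range_add, List.map_append, List.prod_append, List.map_map,
    List.prod_eq_one (l := List.map _ (List.range n)) (by simp), mul_one]
  congr 1
  refine List.map_congr_left fun j hj => ?_
  rw [if_pos (List.mem_range.1 hj), pow_one]

theorem eps_eq_listEsymm (a k : ℕ) :
    eps a k = listEsymm ((List.range a).map (signedVar (xv a))) k := by
  rw [listEsymm_range, eps]
  refine Finset.sum_congr rfl fun t _ => ?_
  congr 1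
  refine List.map_congr_left fun i _ => ?_
  rw [xt, OX_eq_xv, signedVar]

/-- the odd Schur polynomial of the column (1^k) equals
(−1)^{k(k−1)/2} ε_k. -/
theorem odd_schur_column (a : ℕ)
    (s : ℕ → OPol a →+* OPol a)
    (hs : ∀ i j : ℕ, 1 ≤ i → i + 1 ≤ a → 1 ≤ j → j ≤ a →
      s i (xv a j) =
        if j = i then -xv a (i + 1) else if j = i + 1 then -xv a i else -xv a j)
    (d : ℕ → OPol a →+ OPol a)
    (hd1 : ∀ i : ℕ, 1 ≤ i → i + 1 ≤ a → d i 1 = 0)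
    (hdx : ∀ i j : ℕ, 1 ≤ i → i + 1 ≤ a → 1 ≤ j → j ≤ a →
      d i (xv a j) = if j = i ∨ j = i + 1 then 1 else 0)
    (hdL : ∀ i : ℕ, 1 ≤ i → i + 1 ≤ a → ∀ f g : OPol a,
      d i (f * g) = d i f * g + s i f * d i g)
    (W0 : OPol a →+* OPol a)
    (hW0 : ∀ i : Fin a, W0 (OX i) = (-1 : OPol a) ^ Nat.choose a 2 * OX (Fin.rev i)) :
    ∀ k : ℕ, 1 ≤ k → k ≤ a →
      schurP a d W0 (fun i => if (i : ℕ) < k then 1 else 0) =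
        (-1 : OPol a) ^ Nat.choose k 2 * eps a k := by
  intro k _ hk
  have H : IsOddDivDiff a (xv a) s d :=
    ⟨fun _ _ => xv_anticomm a, closure_xv_eq_top a, hs, hd1, hdx, hdL⟩
  have hW : ∀ j < a, W0 (xv a (j + 1)) = (-1) ^ a.choose 2 * xv a (a - 1 - j + 1) := by
    intro j hj
    have h := hW0 ⟨j, hj⟩
    rw [OX_eq_xv, OX_eq_xv, Fin.val_rev] at h
    rw [show a - 1 - j + 1 = a - (j + 1) + 1 by omega]
    exact h
  rw [schurP, dword_eq_opWord, xmon_column hk, xdelta_eq_stairInit, eps_eq_listEsymm]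
  exact H.schur_column (by omega) hk hW
end

section
/- Let e_a := ∂̄_1∘(∂̄_2∘∂̄_1)∘⋯∘(∂̄_{a−1}∘∂̄_{a−2}∘⋯∘∂̄_1), where ∂̄_r = x_r∘∂_r. Then: (1) e_a = (−1)^{C(a,3)} · m(x^{δ_a})∘D_a, where m(x^{δ_a}) denotes left multiplication by x^{δ_a} and C(a,3) = a(a−1)(a−2)/6; (2) D_a∘e_a = D_a; (3) e_a is idempotent, e_a∘e_a = e_a; and (4) D_a(x^{δ_a}) = (−1)^{C(a,3)}. -/
open scoped BigOperators

/-- Operators `d i` on a ring satisfying the odd divided difference rules with respect to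
anticommuting elements `x 1, …, x a` which generate the ring. -/
structure IsOddDividedDifference {R : Type*} [Ring R] (a : ℕ) (x : ℕ → R) (d : ℕ → R →+ R) :
    Prop where
  anticomm : ∀ i j, i ≠ j → x i * x j = -(x j * x i)
  one : ∀ i, 1 ≤ i → i + 1 ≤ a → d i 1 = 0
  self : ∀ i, 1 ≤ i → i + 1 ≤ a → ∀ f, d i (x i * f) = f - x (i + 1) * d i f
  succ : ∀ i, 1 ≤ i → i + 1 ≤ a → ∀ f, d i (x (i + 1) * f) = f - x i * d i f
  other : ∀ i j, 1 ≤ i → i + 1 ≤ a → 1 ≤ j → j ≤ a → j ≠ i → j ≠ i + 1 →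
    ∀ f, d i (x j * f) = -(x j * d i f)
  closure : ∀ S : AddSubgroup R, 1 ∈ S → (∀ j, 1 ≤ j → j ≤ a → ∀ f ∈ S, x j * f ∈ S) → S = ⊤

/-- The composite `d (j+k-1) ∘ ⋯ ∘ d (j+1) ∘ d j`. -/
def descComp {R : Type*} [Ring R] (d : ℕ → R →+ R) (j : ℕ) : ℕ → (R →+ R)
  | 0 => AddMonoidHom.id R
  | k + 1 => (d (j + k)).comp (descComp d j k)

/-- The composite `d 1 ∘ (d 2 ∘ d 1) ∘ ⋯ ∘ (d (n-1) ∘ ⋯ ∘ d 1)`. -/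
def longestComp {R : Type*} [Ring R] (d : ℕ → R →+ R) : ℕ → (R →+ R)
  | 0 => AddMonoidHom.id R
  | n + 1 => (longestComp d n).comp (descComp d 1 n)

/-- The product `x j * x (j+1) * ⋯ * x (j+m-1)`. -/
def ascProd {R : Type*} [Ring R] (x : ℕ → R) : ℕ → ℕ → R
  | _, 0 => 1
  | j, m + 1 => x j * ascProd x (j + 1) m

/-- The staircase product `x j ^ k * x (j+1) ^ (k-1) * ⋯ * x (j+k-1)`. -/
def stairProd {R : Type*} [Ring R] (x : ℕ → R) : ℕ → ℕ → R
  | _, 0 => 1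
  | j, k + 1 => x j ^ (k + 1) * stairProd x (j + 1) k

section Products

variable {R : Type*} [Ring R] {x : ℕ → R} {d : ℕ → R →+ R}

theorem descComp_succ_apply (j k : ℕ) (f : R) :
    descComp d j (k + 1) f = descComp d (j + 1) k (d j f) := by
  induction k with
  | zero => simp [descComp]
  | succ k ih =>
    rw [descComp, AddMonoidHom.comp_apply, ih, descComp, AddMonoidHom.comp_apply]
    congr 2
    omega

theorem ascProd_succ (j m : ℕ) : ascProd x j (m + 1) = ascProd x j m * x (j + m) := by
  induction m generalizing j with
  | zero => simp [ascProd]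
  | succ m ih =>
    rw [ascProd, ih (j + 1), ascProd, mul_assoc]
    congr 3
    omega

theorem mul_pow_of_anticomm {u v : R} (h : u * v = -(v * u)) (m : ℕ) :
    u ^ m * v = (-1 : ℤ) ^ m • (v * u ^ m) := by
  induction m with
  | zero => simp
  | succ m ih =>
    rw [pow_succ', mul_assoc, ih, mul_smul_comm, ← mul_assoc, h, neg_mul, mul_assoc, pow_succ]
    simp

theorem stairProd_eq_prod (j k : ℕ) :
    ((List.range (k + 1)).map fun i => x (j + i) ^ (k - i)).prod = stairProd x j k := by
  induction k generalizing j with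
  | zero => simp [stairProd]
  | succ k ih =>
    rw [List.range_succ_eq_map, List.map_cons, List.map_map, List.prod_cons, stairProd,
      ← ih (j + 1)]
    congr 2
    refine List.map_congr_left fun i _ => ?_
    rw [Function.comp_apply, Nat.succ_eq_add_one, Nat.add_sub_add_right, add_right_comm, add_assoc]

theorem ascProd_mul_of_ge (hx : ∀ i j, i ≠ j → x i * x j = -(x j * x i)) (i j m : ℕ)
    (h : j + m ≤ i) : ascProd x j m * x i = (-1 : ℤ) ^ m • (x i * ascProd x j m) := by
  induction m generalizing j with
  | zero => simp [ascProd]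
  | succ m ih =>
    rw [ascProd, mul_assoc, ih (j + 1) (by omega), mul_smul_comm, ← mul_assoc,
      hx j i (by omega), neg_mul, mul_assoc, pow_succ]
    simp

theorem stairProd_mul_of_lt (hx : ∀ i j, i ≠ j → x i * x j = -(x j * x i)) (i j k : ℕ)
    (h : i < j) :
    stairProd x j k * x i = (-1 : ℤ) ^ (k + 1).choose 2 • (x i * stairProd x j k) := by
  induction k generalizing j with
  | zero => simp [stairProd]
  | succ k ih =>
    rw [stairProd, mul_assoc, ih (j + 1) (by omega), mul_smul_comm, ← mul_assoc,
      mul_pow_of_anticomm (hx j i (by omega)), smul_mul_assoc, mul_assoc, smul_smul, ← pow_add]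
    congr 2
    rw [Nat.choose_succ_succ' (k + 1) 1, Nat.choose_one_right, add_comm]

theorem stairProd_mul_ascProd (hx : ∀ i j, i ≠ j → x i * x j = -(x j * x i)) (j k : ℕ) :
    stairProd x j k * ascProd x j (k + 1) =
      (-1 : ℤ) ^ (k + 1).choose 3 • stairProd x j (k + 1) := by
  induction k generalizing j with
  | zero => simp [stairProd, ascProd, Nat.choose]
  | succ k ih =>
    calc stairProd x j (k + 1) * ascProd x j (k + 2)
        = x j ^ (k + 1) * (stairProd x (j + 1) k * x j) * ascProd x (j + 1) (k + 1) := by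
          simp only [stairProd, ascProd, mul_assoc]
      _ = (-1 : ℤ) ^ (k + 1).choose 2 •
            (x j ^ (k + 2) * (stairProd x (j + 1) k * ascProd x (j + 1) (k + 1))) := by
          rw [stairProd_mul_of_lt hx _ _ _ (Nat.lt_succ_self j), pow_succ (x j) (k + 1)]
          simp only [mul_smul_comm, smul_mul_assoc, mul_assoc]
      _ = _ := by
          rw [ih, mul_smul_comm, smul_smul, ← pow_add, Nat.choose_succ_succ' (k + 1) 2]
          rfl

end Products

namespace IsOddDividedDifference

variable {R : Type*} [Ring R] {a : ℕ} {x : ℕ → R} {d : ℕ → R →+ R}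

theorem eq_zero_of_mul (h : IsOddDividedDifference a x d) (T : R →+ R) (h1 : T 1 = 0)
    (hT : ∀ j, 1 ≤ j → j ≤ a → ∀ f, T f = 0 → T (x j * f) = 0) (f : R) : T f = 0 := by
  have := h.closure T.ker h1 hT
  exact (this ▸ AddSubgroup.mem_top f : f ∈ T.ker)

theorem sq_zero (h : IsOddDividedDifference a x d) {i : ℕ} (hi : 1 ≤ i) (hia : i + 1 ≤ a)
    (f : R) : d i (d i f) = 0 := by
  refine h.eq_zero_of_mul ((d i).comp (d i)) (by simp [h.one i hi hia]) ?_ f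
  intro j hj hja f hf
  simp only [AddMonoidHom.comp_apply] at hf ⊢
  by_cases h1 : j = i
  · subst h1
    simp [h.self j hi hia, h.succ j hi hia, hf]
  by_cases h2 : j = i + 1
  · subst h2
    simp [h.self i hi hia, h.succ i hi hia, hf]
  · simp [h.other i j hi hia hj hja h1 h2, hf]

theorem anticommute (h : IsOddDividedDifference a x d) {i k : ℕ} (hi : 1 ≤ i)
    (hik : i + 2 ≤ k) (hka : k + 1 ≤ a) (f : R) : d i (d k f) = -d k (d i f) := by
  have hia : i + 1 ≤ a := by omega
  have hk : 1 ≤ k := by omega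
  rw [eq_neg_iff_add_eq_zero]
  refine h.eq_zero_of_mul ((d i).comp (d k) + (d k).comp (d i))
    (by simp [h.one i hi hia, h.one k hk hka]) ?_ f
  intro j hj hja f hf
  simp only [AddMonoidHom.add_apply, AddMonoidHom.comp_apply] at hf ⊢
  have hf := eq_neg_of_add_eq_zero_left hf
  have e1 := h.self i hi hia
  have e2 := h.succ i hi hia
  have e3 := h.self k hk hka
  have e4 := h.succ k hk hka
  have e5 := h.other i k hi hia hk (by omega) (by omega) (by omega)
  have e6 := h.other i (k + 1) hi hia (by omega) (by omega) (by omega) (by omega)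
  have e7 := h.other k i hk hka hi (by omega) (by omega) (by omega)
  have e8 := h.other k (i + 1) hk hka (by omega) (by omega) (by omega) (by omega)
  by_cases h1 : j = i
  · subst h1; simp [e1, e7, e8, hf]
  by_cases h2 : j = i + 1
  · subst h2; simp [e2, e7, e8, hf]
  by_cases h3 : j = k
  · subst h3; simp [e3, e5, e6, hf]
  by_cases h4 : j = k + 1
  · subst h4; simp [e4, e5, e6, hf]
  · simp [h.other i j hi hia hj hja h1 h2, h.other k j hk hka hj hja h3 h4, hf]

theorem braid (h : IsOddDividedDifference a x d) {i : ℕ} (hi : 1 ≤ i) (hia : i + 2 ≤ a)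
    (f : R) : d i (d (i + 1) (d i f)) = d (i + 1) (d i (d (i + 1) f)) := by
  have hia' : i + 1 ≤ a := by omega
  have hk : 1 ≤ i + 1 := by omega
  rw [← sub_eq_zero]
  refine h.eq_zero_of_mul
    ((d i).comp ((d (i + 1)).comp (d i)) - (d (i + 1)).comp ((d i).comp (d (i + 1))))
    (by simp [h.one i hi hia', h.one (i + 1) hk hia]) ?_ f
  intro j hj hja f hf
  simp only [AddMonoidHom.sub_apply, AddMonoidHom.comp_apply] at hf ⊢
  have hf := sub_eq_zero.1 hf
  have e1 := h.self i hi hia'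
  have e2 := h.succ i hi hia'
  have e3 := h.self (i + 1) hk hia
  have e4 := h.succ (i + 1) hk hia
  have e5 := h.other i (i + 1 + 1) hi hia' (by omega) (by omega) (by omega) (by omega)
  have e6 := h.other (i + 1) i hk hia hi (by omega) (by omega) (by omega)
  have z1 := h.sq_zero hi hia'
  have z2 := h.sq_zero hk hia
  by_cases h1 : j = i
  · subst h1; simp [e1, e3, e5, e6, hf, z1, z2]
  by_cases h2 : j = i + 1
  · subst h2; simp only [map_sub, map_neg, e1, e2, e3, e4, e5, e6, hf]; abel
  by_cases h3 : j = i + 1 + 1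
  · subst h3; simp [e2, e4, e5, e6, hf, z1, z2]
  · simp [h.other i j hi hia' hj hja h1 h2, h.other (i + 1) j hk hia hj hja h2 h3, hf]

theorem exists_descComp_of_ge (h : IsOddDividedDifference a x d) {k m : ℕ} (hk : m + 2 ≤ k)
    (hka : k + 1 ≤ a) (f : R) : ∃ g, d k (descComp d 1 m f) = descComp d 1 m g := by
  induction m with
  | zero => exact ⟨_, rfl⟩
  | succ m ih =>
    obtain ⟨g, hg⟩ := ih (by omega)
    refine ⟨-g, ?_⟩
    simp only [descComp, AddMonoidHom.comp_apply, map_neg]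
    rw [← hg, h.anticommute (by omega) (by omega) hka, neg_neg]

theorem exists_descComp_of_lt (h : IsOddDividedDifference a x d) {i n : ℕ} (hi : 1 ≤ i)
    (hin : i < n) (hna : n + 1 ≤ a) (f : R) :
    ∃ g, d i (descComp d 1 n f) = descComp d 1 n g := by
  induction n with
  | zero => omega
  | succ n ih =>
    by_cases hn : i = n
    · obtain ⟨m, rfl⟩ : ∃ m, i = 1 + m := ⟨i - 1, by omega⟩
      subst hn
      obtain ⟨g, hg⟩ := h.exists_descComp_of_ge (k := 1 + m + 1) (m := m) (by omega) hna f
      refine ⟨g, ?_⟩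
      have e : (1 + (1 + m) : ℕ) = 1 + m + 1 := by omega
      have e' : (1 + m : ℕ) = m + 1 := by omega
      have hs : ∀ f, descComp d 1 (1 + m) f = d (1 + m) (descComp d 1 m f) := by
        intro f; rw [e']; simp [descComp, e']
      simp only [descComp, AddMonoidHom.comp_apply, e, hs]
      rw [h.braid (by omega) (by omega), hg]
    · obtain ⟨g, hg⟩ := ih (by omega) (by omega)
      refine ⟨-g, ?_⟩
      simp only [descComp, AddMonoidHom.comp_apply, map_neg]
      rw [← hg, h.anticommute hi (by omega) (by omega)]

theorem exists_longestComp_descComp (h : IsOddDividedDifference a x d) {m n : ℕ} (hmn : m ≤ n)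
    (hna : n + 1 ≤ a) (f : R) :
    ∃ g, longestComp d m (descComp d 1 n f) = descComp d 1 n g := by
  have key : ∀ k < n, ∀ f, ∃ g, descComp d 1 k (descComp d 1 n f) = descComp d 1 n g := by
    intro k
    induction k with
    | zero => exact fun _ f => ⟨f, rfl⟩
    | succ k ih =>
      intro hk f
      obtain ⟨g, hg⟩ := ih (by omega) f
      obtain ⟨g', hg'⟩ := h.exists_descComp_of_lt (i := 1 + k) (by omega) (by omega) hna g
      exact ⟨g', by simp only [descComp, AddMonoidHom.comp_apply, hg, hg']⟩
  induction m generalizing f with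
  | zero => exact ⟨f, rfl⟩
  | succ m ih =>
    obtain ⟨g, hg⟩ := key m (by omega) f
    obtain ⟨g', hg'⟩ := ih (by omega) g
    exact ⟨g', by simp only [longestComp, AddMonoidHom.comp_apply, hg, hg']⟩

theorem apply_longestComp (h : IsOddDividedDifference a x d) {i n : ℕ} (hi : 1 ≤ i)
    (hin : i < n) (hna : n ≤ a) (f : R) : d i (longestComp d n f) = 0 := by
  induction n generalizing f with
  | zero => omega
  | succ n ih =>
    by_cases hn : i = n
    · subst hn
      obtain ⟨g, hg⟩ := h.exists_longestComp_descComp le_rfl hna f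
      obtain ⟨m, rfl⟩ : ∃ m, i = m + 1 := ⟨i - 1, by omega⟩
      rw [longestComp, AddMonoidHom.comp_apply, hg]
      simp only [descComp, AddMonoidHom.comp_apply, add_comm 1 m]
      exact h.sq_zero hi hna _
    · exact ih (by omega) (by omega) _

theorem apply_pow_mul (h : IsOddDividedDifference a x d) {i j : ℕ} (hi : 1 ≤ i)
    (hia : i + 1 ≤ a) (hj : 1 ≤ j) (hja : j ≤ a) (h1 : j ≠ i) (h2 : j ≠ i + 1) (m : ℕ) (f : R) :
    d i (x j ^ m * f) = (-1 : ℤ) ^ m • (x j ^ m * d i f) := by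
  induction m with
  | zero => simp
  | succ m ih =>
    rw [pow_succ', mul_assoc, h.other i j hi hia hj hja h1 h2, ih, mul_smul_comm, mul_assoc,
      pow_succ]
    simp

theorem apply_mul_succ_mul (h : IsOddDividedDifference a x d) {i : ℕ} (hi : 1 ≤ i)
    (hia : i + 1 ≤ a) (f : R) : d i (x i * (x (i + 1) * f)) = -(x i * (x (i + 1) * d i f)) := by
  rw [h.self i hi hia, h.succ i hi hia, mul_sub, sub_sub_cancel, ← mul_assoc,
    h.anticomm (i + 1) i (by omega), neg_mul, mul_assoc]

theorem apply_pow_mul_pow_succ_mul (h : IsOddDividedDifference a x d) {i : ℕ} (hi : 1 ≤ i)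
    (hia : i + 1 ≤ a) (m : ℕ) {f : R} (hf : d i f = 0) :
    d i (x i ^ m * (x (i + 1) ^ m * f)) = 0 := by
  induction m with
  | zero => simpa
  | succ m ih =>
    have e : x i ^ (m + 1) * (x (i + 1) ^ (m + 1) * f) =
        (-1 : ℤ) ^ m • (x i * (x (i + 1) * (x i ^ m * (x (i + 1) ^ m * f)))) := by
      calc _ = x i * (x i ^ m * x (i + 1)) * (x (i + 1) ^ m * f) := by
            simp only [pow_succ', mul_assoc]
        _ = _ := by
            rw [mul_pow_of_anticomm (h.anticomm i (i + 1) (by omega))]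
            simp only [mul_smul_comm, smul_mul_assoc, mul_assoc]
    rw [e, map_zsmul, h.apply_mul_succ_mul hi hia, ih]
    simp

theorem apply_stairProd_of_lt (h : IsOddDividedDifference a x d) {i : ℕ} (hi : 1 ≤ i)
    (hia : i + 1 ≤ a) (j k : ℕ) (hj : i + 2 ≤ j) (hjk : j + k ≤ a + 1) :
    d i (stairProd x j k) = 0 := by
  induction k generalizing j with
  | zero => exact h.one i hi hia
  | succ k ih =>
    rw [stairProd, h.apply_pow_mul hi hia (by omega) (by omega) (by omega) (by omega),
      ih (j + 1) (by omega) (by omega)]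
    simp

theorem descComp_pow_mul (h : IsOddDividedDifference a x d) {j : ℕ} (hj : 1 ≤ j) (k m : ℕ)
    (hjk : j + 1 + k ≤ a) (f : R) :
    descComp d (j + 1) k (x j ^ m * f) =
      (-1 : ℤ) ^ (k * m) • (x j ^ m * descComp d (j + 1) k f) := by
  induction k with
  | zero => simp [descComp]
  | succ k ih =>
    rw [descComp, AddMonoidHom.comp_apply, ih (by omega), map_zsmul,
      h.apply_pow_mul (by omega) (by omega) hj (by omega) (by omega) (by omega), smul_smul,
      ← pow_add, Nat.succ_mul]
    rfl

theorem descComp_stairProd (h : IsOddDividedDifference a x d) {j : ℕ} (hj : 1 ≤ j) (k : ℕ)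
    (hjk : j + k + 1 ≤ a) :
    descComp d j (k + 1) (stairProd x j (k + 1)) =
      (-1 : ℤ) ^ (k + 1).choose 2 • stairProd x j k := by
  induction k generalizing j with
  | zero =>
    have := h.self j hj (by omega) 1
    simp only [h.one j hj (by omega), mul_zero, sub_zero, mul_one] at this
    simp [descComp, stairProd, this]
  | succ k ih =>
    have e : d j (stairProd x j (k + 2)) = x j ^ (k + 1) * stairProd x (j + 1) (k + 1) := by
      rw [stairProd, pow_succ', mul_assoc, h.self j hj (by omega), stairProd,
        h.apply_pow_mul_pow_succ_mul hj (by omega) _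
          (h.apply_stairProd_of_lt hj (by omega) _ _ le_rfl (by omega)), mul_zero, sub_zero]
    rw [descComp_succ_apply, e, h.descComp_pow_mul hj _ _ (by omega),
      ih (j := j + 1) (by omega) (by omega), mul_smul_comm, smul_smul,
      Nat.choose_succ_succ' (k + 1) 1, Nat.choose_one_right, pow_add (-1 : ℤ) (k + 1), stairProd]
    congr 2
    rw [pow_mul]
    rcases neg_one_pow_eq_or ℤ (k + 1) with h' | h' <;> simp only [h', one_pow]

theorem longestComp_stairProd (h : IsOddDividedDifference a x d) (n : ℕ) (hn : n ≤ a) :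
    longestComp d n (stairProd x 1 (n - 1)) = (-1 : ℤ) ^ n.choose 3 • (1 : R) := by
  induction n with
  | zero => simp [longestComp, stairProd]
  | succ n ih =>
    rcases n with _ | n
    · simp [longestComp, descComp, stairProd, Nat.choose]
    · rw [longestComp, AddMonoidHom.comp_apply, Nat.add_sub_cancel,
        h.descComp_stairProd le_rfl n (by omega), map_zsmul]
      have := ih (by omega)
      rw [Nat.add_sub_cancel] at this
      rw [this, smul_smul, ← pow_add, ← Nat.choose_succ_succ' (n + 1) 2]

theorem apply_ascProd_mul_of_ge (h : IsOddDividedDifference a x d) {i j m : ℕ} (hj : 1 ≤ j)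
    (hi : j + m ≤ i ∨ 1 ≤ i ∧ i + 2 ≤ j ∧ j + m ≤ a + 1) (hia : i + 1 ≤ a) (f : R) :
    d i (ascProd x j m * f) = (-1 : ℤ) ^ m • (ascProd x j m * d i f) := by
  induction m generalizing j with
  | zero => simp [ascProd]
  | succ m ih =>
    rw [ascProd, mul_assoc, h.other i j (by omega) hia hj (by omega) (by omega) (by omega),
      ih (by omega) (by omega), mul_smul_comm, mul_assoc, pow_succ]
    simp

theorem apply_ascProd_mul_of_mem (h : IsOddDividedDifference a x d) {i j m : ℕ} (hj : 1 ≤ j)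
    (hi : j ≤ i) (him : i < j + m) (ha : j + m ≤ a) (f : R) :
    d i (ascProd x j (m + 1) * f) = (-1 : ℤ) ^ m • (ascProd x j (m + 1) * d i f) := by
  induction m generalizing j with
  | zero => omega
  | succ m ih =>
    rcases hi.eq_or_lt with rfl | hi
    · simp only [ascProd, mul_assoc]
      rw [h.apply_mul_succ_mul hj (by omega),
        h.apply_ascProd_mul_of_ge (by omega) (by omega) (by omega), pow_succ]
      simp only [mul_smul_comm, mul_neg, mul_one, neg_smul]
    · rw [ascProd, mul_assoc, h.other i j (by omega) (by omega) hj (by omega) (by omega) (by omega),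
        ih (by omega) (by omega) (by omega) (by omega), mul_smul_comm, mul_assoc, pow_succ]
      simp

theorem longestComp_ascProd_mul (h : IsOddDividedDifference a x d) {m : ℕ} (ha : m + 1 ≤ a)
    (f : R) : longestComp d (m + 1) (ascProd x 1 (m + 1) * f) =
      (-1 : ℤ) ^ (m * (m + 1).choose 2) • (ascProd x 1 (m + 1) * longestComp d (m + 1) f) := by
  have key : ∀ k ≤ m, ∀ f, descComp d 1 k (ascProd x 1 (m + 1) * f) =
      (-1 : ℤ) ^ (m * k) • (ascProd x 1 (m + 1) * descComp d 1 k f) := by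
    intro k
    induction k with
    | zero => simp [descComp]
    | succ k ih =>
      intro hk f
      rw [descComp, AddMonoidHom.comp_apply, ih (by omega), map_zsmul,
        h.apply_ascProd_mul_of_mem le_rfl (by omega) (by omega) (by omega), smul_smul, ← pow_add]
      rfl
  have key' : ∀ n ≤ m + 1, ∀ f, longestComp d n (ascProd x 1 (m + 1) * f) =
      (-1 : ℤ) ^ (m * n.choose 2) • (ascProd x 1 (m + 1) * longestComp d n f) := by
    intro n
    induction n with
    | zero => simp [longestComp]
    | succ n ih =>
      intro hn f
      rw [longestComp, AddMonoidHom.comp_apply, key n (by omega), map_zsmul, ih (by omega),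
        smul_smul, ← pow_add, ← mul_add, Nat.choose_succ_succ' n 1, Nat.choose_one_right]
      rfl
  exact key' _ le_rfl f

theorem descComp_mulLeft_comp (h : IsOddDividedDifference a x d) (n : ℕ) (hn : n + 1 ≤ a)
    (f : R) : descComp (fun r => (AddMonoidHom.mulLeft (x r)).comp (d r)) 1 n f =
      ascProd x 1 n * descComp d 1 n f := by
  induction n with
  | zero => simp [descComp, ascProd]
  | succ n ih =>
    rw [descComp, AddMonoidHom.comp_apply, ih (by omega), AddMonoidHom.comp_apply,
      AddMonoidHom.coe_mulLeft, h.apply_ascProd_mul_of_ge le_rfl (by omega) (by omega),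
      ascProd_succ, ascProd_mul_of_ge h.anticomm _ _ _ le_rfl]
    simp only [mul_smul_comm, smul_mul_assoc, mul_assoc]
    rfl

theorem neg_one_pow_choose_three_succ (m : ℕ) :
    (-1 : ℤ) ^ (m + 2).choose 3 = (-1) ^ (m * (m + 1).choose 2) := by
  have : (m + 2) * (m + 1).choose 2 = (m + 2).choose 3 * 3 :=
    Nat.add_one_mul_choose_eq (m + 1) 2
  have h3 : (-1 : ℤ) ^ ((m + 2).choose 3 * 3) = (-1) ^ (m + 2).choose 3 := by
    rw [mul_comm, pow_mul]; norm_num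
  rw [← h3, ← this, add_mul, pow_add, pow_mul (-1 : ℤ) 2]
  simp

theorem longestComp_mulLeft_comp (h : IsOddDividedDifference a x d) (n : ℕ) (hn : n ≤ a)
    (f : R) : longestComp (fun r => (AddMonoidHom.mulLeft (x r)).comp (d r)) n f =
      (-1 : ℤ) ^ n.choose 3 • (stairProd x 1 (n - 1) * longestComp d n f) := by
  induction n generalizing f with
  | zero => simp [longestComp, stairProd]
  | succ n ih =>
    rcases n with _ | m
    · simp [longestComp, descComp, stairProd, Nat.choose]
    · rw [longestComp, AddMonoidHom.comp_apply, h.descComp_mulLeft_comp _ hn, ih (by omega),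
        h.longestComp_ascProd_mul (by omega), neg_one_pow_choose_three_succ, mul_smul_comm,
        ← mul_assoc, Nat.add_sub_cancel, stairProd_mul_ascProd h.anticomm, smul_mul_assoc,
        smul_comm, smul_smul, smul_smul, Nat.add_sub_cancel,
        longestComp.eq_2 d (m + 1), AddMonoidHom.comp_apply]
      congr 1
      rcases neg_one_pow_eq_or ℤ ((m + 1).choose 3) with h' | h' <;> simp [h']

end IsOddDividedDifference

theorem dword_append {a : ℕ} (d : ℕ → OPol a →+ OPol a) (l l' : List ℕ) (f : OPol a) :
    dword d (l ++ l') f = dword d l (dword d l' f) := by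
  induction l with
  | nil => rfl
  | cons i l ih => simp [dword, ih]

theorem dword_DList {a : ℕ} (d : ℕ → OPol a →+ OPol a) (n : ℕ) (f : OPol a) :
    dword d (DList n) f = longestComp d n f := by
  have key : ∀ k f, dword d ((List.range k).reverse.map (· + 1)) f = descComp d 1 k f := by
    intro k
    induction k with
    | zero => intro f; rfl
    | succ k ih =>
      intro f
      rw [List.range_succ, List.reverse_append, List.reverse_singleton, List.singleton_append,
        List.map_cons, dword, AddMonoidHom.comp_apply, ih, descComp, AddMonoidHom.comp_apply,
        add_comm]
  induction n generalizing f with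
  | zero => rfl
  | succ n ih =>
    have e : DList (n + 1) = DList n ++ (List.range n).reverse.map (· + 1) := by
      simp [DList, List.range_succ]
    rw [e, dword_append, key, ih, longestComp, AddMonoidHom.comp_apply]

theorem xdelta_eq_stairProd (a : ℕ) : xdelta a = stairProd (xv a) 1 (a - 1) := by
  rcases a with _ | n
  · simp [xdelta, stairProd]
  · rw [Nat.add_sub_cancel, ← stairProd_eq_prod, xdelta, ← List.map_coe_finRange_eq_range,
      List.map_map]
    congr 1
    refine List.map_congr_left fun i _ => ?_
    rw [OX_eq_xv, Function.comp_apply, add_comm 1, Nat.add_sub_cancel]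

theorem OX_anticomm {a : ℕ} {i j : Fin a} (h : i ≠ j) : OX i * OX j = -(OX j * OX i) := by
  have := RingQuot.mkRingHom_rel (OddRel.anticomm i j h)
  rw [map_mul, map_neg, map_mul] at this
  exact this

/-- `neg_mul` for the negation that `RingQuot` provides directly. -/
theorem OPol_neg_mul {a : ℕ} (f g : OPol a) : -f * g = -(f * g) := by
  have h := neg_mul (α := OPol a) f g
  exact h

theorem OPol_addSubgroup_eq_top {a : ℕ} (S : AddSubgroup (OPol a)) (h1 : 1 ∈ S)
    (hS : ∀ j, 1 ≤ j → j ≤ a → ∀ f ∈ S, xv a j * f ∈ S) : S = ⊤ := by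
  have key : ∀ p : FreeAlgebra ℤ (Fin a), ∀ f ∈ S, RingQuot.mkRingHom (OddRel a) p * f ∈ S := by
    intro p
    induction p using FreeAlgebra.induction with
    | grade0 r =>
      intro f hf
      rw [eq_intCast (algebraMap ℤ (FreeAlgebra ℤ (Fin a))), map_intCast, ← zsmul_eq_mul]
      exact S.zsmul_mem hf r
    | grade1 i =>
      intro f hf
      have := hS (i + 1) (by omega) (by omega) f hf
      rwa [← OX_eq_xv] at this
    | mul p q hp hq =>
      intro f hf
      rw [map_mul, mul_assoc]
      exact hp _ (hq _ hf)
    | add p q hp hq =>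
      intro f hf
      rw [map_add, add_mul]
      exact S.add_mem (hp _ hf) (hq _ hf)
  refine (AddSubgroup.eq_top_iff' S).2 fun f => ?_
  obtain ⟨p, rfl⟩ := RingQuot.mkRingHom_surjective (OddRel a) f
  simpa using key p 1 h1

/-- the element e_a = ∂̄_{w₀} satisfies
e_a = (−1)^{C(a,3)}·x^{δ_a}·D_a, D_a∘e_a = D_a, e_a is idempotent, and
D_a(x^{δ_a}) = (−1)^{C(a,3)}. -/
theorem ea_idempotent (a : ℕ)
    (s : ℕ → OPol a →+* OPol a)
    (hs : ∀ i j : ℕ, 1 ≤ i → i + 1 ≤ a → 1 ≤ j → j ≤ a →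
      s i (xv a j) =
        if j = i then -xv a (i + 1) else if j = i + 1 then -xv a i else -xv a j)
    (d : ℕ → OPol a →+ OPol a)
    (hd1 : ∀ i : ℕ, 1 ≤ i → i + 1 ≤ a → d i 1 = 0)
    (hdx : ∀ i j : ℕ, 1 ≤ i → i + 1 ≤ a → 1 ≤ j → j ≤ a →
      d i (xv a j) = if j = i ∨ j = i + 1 then 1 else 0)
    (hdL : ∀ i : ℕ, 1 ≤ i → i + 1 ≤ a → ∀ f g : OPol a,
      d i (f * g) = d i f * g + s i f * d i g) :
    (∀ f : OPol a, dword (dbar a d) (DList a) f =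
      (-1 : OPol a) ^ Nat.choose a 3 * (xdelta a * dword d (DList a) f)) ∧
    (∀ f : OPol a,
      dword d (DList a) (dword (dbar a d) (DList a) f) = dword d (DList a) f) ∧
    (∀ f : OPol a,
      dword (dbar a d) (DList a) (dword (dbar a d) (DList a) f) =
        dword (dbar a d) (DList a) f) ∧
    dword d (DList a) (xdelta a) = (-1 : OPol a) ^ Nat.choose a 3 := by
  have h : IsOddDividedDifference a (xv a) d :=
    { anticomm := fun i j hij => xv_anticomm a hij
      one := hd1
      self := fun i hi hia f => by
        rw [hdL i hi hia, hdx i i hi hia hi (by omega), hs i i hi hia hi (by omega)]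
        rw [if_pos (by omega), one_mul, sub_eq_add_neg]
        simp only [↓reduceIte]
        exact congrArg (f + ·) (OPol_neg_mul _ _)
      succ := fun i hi hia f => by
        rw [hdL i hi hia, hdx i (i + 1) hi hia (by omega) hia,
          hs i (i + 1) hi hia (by omega) hia]
        rw [if_pos (by omega), if_neg (by omega), if_pos rfl, one_mul, sub_eq_add_neg]
        exact congrArg (f + ·) (OPol_neg_mul _ _)
      other := fun i j hi hia hj hja h1 h2 f => by
        rw [hdL i hi hia, hdx i j hi hia hj hja, hs i j hi hia hj hja]
        rw [if_neg (by omega), if_neg h1, if_neg h2, zero_mul, zero_add]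
        exact OPol_neg_mul _ _
      closure := OPol_addSubgroup_eq_top }
  have cast : ∀ (k : ℕ) (f : OPol a), (-1 : ℤ) ^ k • f = (-1 : OPol a) ^ k * f := by
    intro k f
    rw [zsmul_eq_mul]
    push_cast
    rfl
  have h4 : dword d (DList a) (xdelta a) = (-1 : OPol a) ^ Nat.choose a 3 := by
    rw [dword_DList, xdelta_eq_stairProd, h.longestComp_stairProd a le_rfl, cast, mul_one]
  have h1 : ∀ f : OPol a, dword (dbar a d) (DList a) f =
      (-1 : OPol a) ^ Nat.choose a 3 * (xdelta a * dword d (DList a) f) := by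
    intro f
    rw [dword_DList, dword_DList, xdelta_eq_stairProd, ← cast]
    exact h.longestComp_mulLeft_comp a le_rfl f
  have hlin : ∀ l : List ℕ, (∀ i ∈ l, 1 ≤ i ∧ i + 1 ≤ a) → ∀ f g : OPol a,
      (∀ i, 1 ≤ i → i + 1 ≤ a → d i g = 0) → dword d l (f * g) = dword d l f * g := by
    intro l hl f g hg
    induction l with
    | nil => rfl
    | cons i l ih =>
      have hi := hl i List.mem_cons_self
      simp only [dword, AddMonoidHom.comp_apply]
      rw [ih fun j hj => hl j (List.mem_cons_of_mem i hj), hdL i hi.1 hi.2, hg i hi.1 hi.2,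
        mul_zero, add_zero]
  have hmem : ∀ i ∈ DList a, 1 ≤ i ∧ i + 1 ≤ a := by
    intro i hi
    simp only [DList, List.mem_flatten, List.mem_map, List.mem_range] at hi
    obtain ⟨_, ⟨b, hb, rfl⟩, hi⟩ := hi
    simp only [List.mem_map, List.mem_reverse, List.mem_range] at hi
    obtain ⟨c, hc, rfl⟩ := hi
    omega
  have h2 : ∀ f : OPol a,
      dword d (DList a) (dword (dbar a d) (DList a) f) = dword d (DList a) f := by
    intro f
    have hker : ∀ i, 1 ≤ i → i + 1 ≤ a → d i (dword d (DList a) f) = 0 := by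
      intro i hi hia
      rw [dword_DList]
      exact h.apply_longestComp hi hia le_rfl f
    rw [h1, ← cast, map_zsmul, hlin _ hmem _ _ hker, h4, ← cast, smul_smul, ← mul_pow]
    simp
  refine ⟨h1, h2, fun f => ?_, h4⟩
  rw [h1 (dword (dbar a d) (DList a) f), h2, ← h1]
end
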